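/- Variational Principle: Let (X, T) be a topological dynamical system (X a compact metric space, T : X → X a homeomorphism). Then (a) for every T-invariant Borel probability measure μ on X, h_μ(T) ≤ h_top(T); and (b) sup{h_μ(T) : μ a T-invariant ergodic Borel probability measure on X} = h_top(T). -/

import Mathlib

open MeasureTheory Filter Topology
open scoped Classical

variable {X : Type*} [MeasurableSpace X]

noncomputable def cJoin (U V : Finset (Set X)) : Finset (Set X) :=
  (U ×ˢ V).image fun p => p.1 ∩ p.2

noncomputable def preC (S : X → X) (U : Finset (Set X)) : Finset (Set X) :=
  U.image fun A => S ⁻¹' A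

noncomputable def joinN (S : X → X) (U : Finset (Set X)) : ℕ → Finset (Set X)
  | 0 => {Set.univ}
  | n + 1 => cJoin (joinN S U n) (preC (S^[n]) U)

def IsMCover (U : Finset (Set X)) : Prop :=
  (∀ A ∈ U, MeasurableSet A) ∧ ⋃₀ (U : Set (Set X)) = Set.univ

def IsMPartition (U : Finset (Set X)) : Prop :=
  IsMCover U ∧ ∀ A ∈ U, ∀ B ∈ U, A ≠ B → Disjoint A B

def Refines (α U : Finset (Set X)) : Prop := ∀ A ∈ α, ∃ B ∈ U, A ⊆ B

noncomputable def entPart (μ : Measure X) (α : Finset (Set X)) : ℝ :=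
  ∑ A ∈ α, Real.negMulLog (μ A).toReal

noncomputable def entCover (μ : Measure X) (U : Finset (Set X)) : ℝ :=
  sInf {h | ∃ α : Finset (Set X), IsMPartition α ∧ Refines α U ∧ h = entPart μ α}

noncomputable def hPart (μ : Measure X) (S : X → X) (α : Finset (Set X)) : ℝ :=
  limUnder atTop fun n : ℕ => entPart μ (joinN S α n) / n

noncomputable def hPlusC (μ : Measure X) (S : X → X) (U : Finset (Set X)) : ℝ :=
  sInf {h | ∃ α : Finset (Set X), IsMPartition α ∧ Refines α U ∧ h = hPart μ S α}

noncomputable def hMinusC (μ : Measure X) (S : X → X) (U : Finset (Set X)) : ℝ :=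
  limUnder atTop fun n : ℕ => entCover μ (joinN S U n) / n

noncomputable def covN (μ : Measure X) (V : Finset (Set X)) (ε : ℝ) : ℕ :=
  sInf {m | ∃ W ⊆ V, W.card = m ∧ 1 - ε < (μ (⋃₀ (W : Set (Set X)))).toReal}

noncomputable def covNfull (V : Finset (Set X)) : ℕ :=
  sInf {m | ∃ W ⊆ V, W.card = m ∧ ⋃₀ (W : Set (Set X)) = Set.univ}
/-- Kolmogorov–Sinai entropy of the system: supremum (in `ENNReal`) of the entropies
of finite measurable partitions. -/
noncomputable def hKS {X : Type*} [MeasurableSpace X] (μ : Measure X) (S : X → X) : ENNReal :=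
  ⨆ α : {α : Finset (Set X) // IsMPartition α}, ENNReal.ofReal (hPart μ S (↑α))

/-- Topological entropy of the system: supremum (in `ENNReal`) over finite open covers
of `h_top(𝓤, T) = lim_n (1/n)·log 𝓝(𝓤₀^{n−1})`. -/
noncomputable def hTop {X : Type*} [TopologicalSpace X] (S : X → X) : ENNReal :=
  ⨆ U : {U : Finset (Set X) // (∀ A ∈ U, IsOpen A) ∧ ⋃₀ (U : Set (Set X)) = Set.univ},
    ENNReal.ofReal (limUnder atTop fun n : ℕ => Real.log (covNfull (joinN S (↑U) n)) / n)

section Shannon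

variable {ι κ : Type*}

/-- A labelling of the points of a measurable space all of whose fibres are measurable. -/
def MeasLabel (f : X → ι) : Prop := ∀ i, MeasurableSet (f ⁻¹' {i})

/-- Shannon entropy of the partition into fibres of a finite labelling. -/
noncomputable def labelEnt [Fintype ι] (μ : Measure X) (f : X → ι) : ℝ :=
  ∑ i, Real.negMulLog (μ.real (f ⁻¹' {i}))

/-- The labelling of a point by the labels of its first `n` iterates. -/
def itin (S : X → X) (f : X → ι) (n : ℕ) (x : X) : Fin n → ι := fun i => f (S^[i] x)

lemma MeasLabel.preimage [Finite ι] {f : X → ι} (hf : MeasLabel f) (s : Set ι) :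
    MeasurableSet (f ⁻¹' s) := by
  rw [← Set.biUnion_preimage_singleton]
  exact (Set.toFinite s).measurableSet_biUnion fun i _ => hf i

lemma MeasLabel.comp_left [Finite ι] {f : X → ι} (hf : MeasLabel f) (φ : ι → κ) :
    MeasLabel (fun x => φ (f x)) := fun k => hf.preimage (φ ⁻¹' {k})

lemma MeasLabel.comp_right {f : X → ι} (hf : MeasLabel f) {S : X → X} (hS : Measurable S) :
    MeasLabel (fun x => f (S x)) := fun i => hS (hf i)

lemma MeasLabel.prodMk {f : X → ι} {g : X → κ} (hf : MeasLabel f) (hg : MeasLabel g) :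
    MeasLabel (fun x => (f x, g x)) := by
  rintro ⟨i, k⟩
  convert (hf i).inter (hg k) using 1
  ext x; simp

lemma MeasLabel.pi {J : Type*} [Countable J] {f : J → X → ι} (hf : ∀ j, MeasLabel (f j)) :
    MeasLabel (fun x j => f j x) := by
  intro u
  convert MeasurableSet.iInter fun j => hf j (u j) using 1
  ext x; simp [funext_iff]

lemma MeasLabel.itin {f : X → ι} (hf : MeasLabel f) {S : X → X} (hS : Measurable S) (n : ℕ) :
    MeasLabel (itin S f n) := .pi fun i => hf.comp_right (hS.iterate i)

lemma negMulLog_sum_le {J : Type*} (s : Finset J) (p : J → ℝ) (hp : ∀ j ∈ s, 0 ≤ p j) :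
    Real.negMulLog (∑ j ∈ s, p j) ≤ ∑ j ∈ s, Real.negMulLog (p j) := by
  have h : Real.negMulLog (∑ j ∈ s, p j) = ∑ j ∈ s, -(p j * Real.log (∑ j ∈ s, p j)) := by
    rw [Finset.sum_neg_distrib, ← Finset.sum_mul, Real.negMulLog, neg_mul]
  rw [h]
  refine Finset.sum_le_sum fun j hj => ?_
  rcases (hp j hj).eq_or_lt with h0 | h0
  · simp [← h0]
  · rw [Real.negMulLog, neg_mul]
    have := Real.log_le_log h0 (Finset.single_le_sum hp hj)
    nlinarith

lemma log_sum_le_negMulLog_add {a b c d : ℝ} (ha : 0 ≤ a) (hab : a ≤ b) (hac : a ≤ c)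
    (hcd : c ≤ d) :
    a * (Real.log b + Real.log c - Real.log a - Real.log d) ≤ b * c / d - a := by
  rcases ha.eq_or_lt with rfl | h0
  · simp only [zero_mul, sub_zero]
    exact div_nonneg (mul_nonneg hab hac) (hac.trans hcd)
  · have hb : 0 < b := h0.trans_le hab
    have hc : 0 < c := h0.trans_le hac
    have hd : 0 < d := hc.trans_le hcd
    have h1 := Real.log_le_sub_one_of_pos (x := b * c / (a * d)) (by positivity)
    rw [Real.log_div (by positivity) (by positivity), Real.log_mul hb.ne' hc.ne',
      Real.log_mul h0.ne' hd.ne'] at h1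
    calc _ = a * (Real.log b + Real.log c - (Real.log a + Real.log d)) := by ring
      _ ≤ a * (b * c / (a * d) - 1) := by gcongr
      _ = b * c / d - a := by field_simp

lemma negMulLog_sum_add_le {A B : Type*} [Fintype A] [Fintype B]
    (p : A → B → ℝ) (hp : ∀ a b, 0 ≤ p a b) :
    ∑ a, ∑ b, Real.negMulLog (p a b) + Real.negMulLog (∑ a, ∑ b, p a b) ≤
      ∑ a, Real.negMulLog (∑ b, p a b) + ∑ b, Real.negMulLog (∑ a, p a b) := by
  set q : A → ℝ := fun a => ∑ b, p a b with hq
  set r : B → ℝ := fun b => ∑ a, p a b with hr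
  set s : ℝ := ∑ a, q a with hs
  have hsr : s = ∑ b, r b := Finset.sum_comm
  have hr0 : ∀ b, 0 ≤ r b := fun b => Finset.sum_nonneg fun _ _ => hp _ _
  have key : ∑ a, ∑ b, p a b *
      (Real.log (q a) + Real.log (r b) - Real.log (p a b) - Real.log s) ≤ 0 := by
    calc _ ≤ ∑ a, ∑ b, (q a * r b / s - p a b) := by
          refine Finset.sum_le_sum fun a _ => Finset.sum_le_sum fun b _ => ?_
          refine log_sum_le_negMulLog_add (hp a b) ?_ ?_ ?_
          · exact Finset.single_le_sum (f := fun b => p a b) (fun _ _ => hp _ _) (Finset.mem_univ b)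
          · exact Finset.single_le_sum (f := fun a => p a b) (fun _ _ => hp _ _)
              (Finset.mem_univ a)
          · rw [hsr]
            exact Finset.single_le_sum (f := r) (fun _ _ => hr0 _) (Finset.mem_univ b)
      _ = s * s / s - s := by
          simp only [Finset.sum_sub_distrib]
          congr 1
          rw [show s * s = (∑ a, q a) * ∑ b, r b by rw [← hsr], Finset.sum_mul_sum]
          simp_rw [Finset.sum_div]
      _ = 0 := by
          by_cases h : s = 0
          · simp [h]
          · field_simp; simp
  have e1 : ∑ a, ∑ b, p a b * Real.log (q a) = ∑ a, q a * Real.log (q a) := by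
    simp_rw [← Finset.sum_mul]; rfl
  have e2 : ∑ a, ∑ b, p a b * Real.log (r b) = ∑ b, r b * Real.log (r b) := by
    rw [Finset.sum_comm]; simp_rw [← Finset.sum_mul]; rfl
  have e3 : ∑ a, ∑ b, p a b * Real.log s = s * Real.log s := by
    simp_rw [← Finset.sum_mul]; rfl
  simp only [mul_sub, mul_add, Finset.sum_sub_distrib, Finset.sum_add_distrib, e1, e2, e3] at key
  simp only [Real.negMulLog, neg_mul, Finset.sum_neg_distrib]
  linarith

lemma MeasLabel.measureReal_preimage {f : X → ι} (hf : MeasLabel f) (μ : Measure X)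
    [IsFiniteMeasure μ] (s : Finset ι) :
    μ.real (f ⁻¹' s) = ∑ i ∈ s, μ.real (f ⁻¹' {i}) := by
  rw [← Set.biUnion_preimage_singleton]
  refine measureReal_biUnion_finset (fun i _ j _ hij => ?_) (fun i _ => hf i)
  exact Disjoint.preimage _ (by simpa using hij)

section Probability

variable [Fintype ι] [Fintype κ] {μ : Measure X} [IsProbabilityMeasure μ]

lemma MeasLabel.sum_measureReal {f : X → ι} (hf : MeasLabel f) :
    ∑ i, μ.real (f ⁻¹' {i}) = 1 := by
  rw [← hf.measureReal_preimage]; simp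

lemma labelEnt_nonneg (f : X → ι) : 0 ≤ labelEnt μ f :=
  Finset.sum_nonneg fun _ _ => Real.negMulLog_nonneg measureReal_nonneg measureReal_le_one

lemma labelEnt_comp_le {f : X → ι} (hf : MeasLabel f) {g : X → κ} (φ : ι → κ)
    (hg : ∀ x, g x = φ (f x)) : labelEnt μ g ≤ labelEnt μ f := by
  calc labelEnt μ g ≤ ∑ k, ∑ i with φ i = k, Real.negMulLog (μ.real (f ⁻¹' {i})) := by
        refine Finset.sum_le_sum fun k _ => ?_
        have : g ⁻¹' {k} = f ⁻¹' (Finset.univ.filter fun i => φ i = k : Finset ι) := by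
          ext x; simp [hg]
        rw [this, hf.measureReal_preimage]
        exact negMulLog_sum_le _ _ fun _ _ => measureReal_nonneg
    _ = labelEnt μ f := Finset.sum_fiberwise _ _ _

lemma labelEnt_prod_add_le {ι' : Type*} [Fintype ι'] {f : X → ι} {g : X → ι'} {h : X → κ}
    (hf : MeasLabel f) (hg : MeasLabel g) (hh : MeasLabel h) :
    labelEnt μ (fun x => (f x, g x, h x)) + labelEnt μ h ≤
      labelEnt μ (fun x => (f x, h x)) + labelEnt μ (fun x => (g x, h x)) := by
  set p : ι → ι' → κ → ℝ := fun a b c => μ.real ((fun x => (f x, g x, h x)) ⁻¹' {(a, b, c)})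
  have hm := hf.prodMk (hg.prodMk hh)
  have e1 : ∀ c, μ.real (h ⁻¹' {c}) = ∑ a, ∑ b, p a b c := by
    intro c
    have : h ⁻¹' {c} = (fun x => (f x, g x, h x)) ⁻¹'
        (Finset.univ ×ˢ Finset.univ ×ˢ {c} : Finset (ι × ι' × κ)) := by
      ext x; simp [eq_comm, and_comm]
    rw [this, hm.measureReal_preimage, Finset.sum_product]
    simp [p]
  have e2 : ∀ a c, μ.real ((fun x => (f x, h x)) ⁻¹' {(a, c)}) = ∑ b, p a b c := by
    intro a c
    have : (fun x => (f x, h x)) ⁻¹' {(a, c)} = (fun x => (f x, g x, h x)) ⁻¹'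
        ({a} ×ˢ Finset.univ ×ˢ {c} : Finset (ι × ι' × κ)) := by
      ext x; simp [eq_comm, and_comm]
    rw [this, hm.measureReal_preimage, Finset.sum_product]
    simp [p]
  have e3 : ∀ b c, μ.real ((fun x => (g x, h x)) ⁻¹' {(b, c)}) = ∑ a, p a b c := by
    intro b c
    have : (fun x => (g x, h x)) ⁻¹' {(b, c)} = (fun x => (f x, g x, h x)) ⁻¹'
        (Finset.univ ×ˢ {b} ×ˢ {c} : Finset (ι × ι' × κ)) := by
      ext x; simp [eq_comm, and_comm]
    rw [this, hm.measureReal_preimage, Finset.sum_product]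
    simp [p]
  have key := Finset.sum_le_sum fun c (_ : c ∈ Finset.univ) =>
    negMulLog_sum_add_le (fun a b => p a b c) fun _ _ => measureReal_nonneg
  simp only [Finset.sum_add_distrib] at key
  have e4 : labelEnt μ (fun x => (f x, g x, h x)) =
      ∑ c, ∑ a, ∑ b, Real.negMulLog (p a b c) := by
    simp only [labelEnt, Fintype.sum_prod_type]
    rw [Finset.sum_comm (s := (Finset.univ : Finset κ))]
    exact Finset.sum_congr rfl fun a _ => Finset.sum_comm
  have e5 : labelEnt μ h = ∑ c, Real.negMulLog (∑ a, ∑ b, p a b c) := by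
    simp only [labelEnt, e1]
  have e6 : labelEnt μ (fun x => (f x, h x)) = ∑ c, ∑ a, Real.negMulLog (∑ b, p a b c) := by
    simp only [labelEnt, Fintype.sum_prod_type, e2]
    exact Finset.sum_comm
  have e7 : labelEnt μ (fun x => (g x, h x)) = ∑ c, ∑ b, Real.negMulLog (∑ a, p a b c) := by
    simp only [labelEnt, Fintype.sum_prod_type, e3]
    exact Finset.sum_comm
  rw [e4, e5, e6, e7]
  exact key

lemma labelEnt_prod_le {f : X → ι} {g : X → κ} (hf : MeasLabel f) (hg : MeasLabel g) :
    labelEnt μ (fun x => (f x, g x)) ≤ labelEnt μ f + labelEnt μ g := by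
  have hu : MeasLabel (fun _ : X => ()) := fun _ => MeasurableSet.const _
  have h1 := labelEnt_prod_add_le (μ := μ) hf hg hu
  have h2 := labelEnt_comp_le (μ := μ) hf (g := fun x => (f x, ())) (fun i => (i, ())) fun _ => rfl
  have h3 := labelEnt_comp_le (μ := μ) hg (g := fun x => (g x, ())) (fun i => (i, ())) fun _ => rfl
  have h4 := labelEnt_comp_le (μ := μ) (hf.prodMk (hg.prodMk hu)) (g := fun x => (f x, g x))
    (fun p => (p.1, p.2.1)) fun _ => rfl
  have h5 := labelEnt_nonneg (μ := μ) (fun _ : X => ())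
  linarith

lemma labelEnt_le_log_card {f : X → ι} (hf : MeasLabel f) (s : Finset ι) (hs : ∀ x, f x ∈ s) :
    labelEnt μ f ≤ Real.log s.card := by
  have h0 : ∀ i ∉ s, μ.real (f ⁻¹' {i}) = 0 := by
    intro i hi
    have : f ⁻¹' {i} = ∅ := by
      ext x
      simp only [Set.mem_preimage, Set.mem_singleton_iff, Set.mem_empty_iff_false, iff_false]
      rintro rfl
      exact hi (hs x)
    simp [this]
  have h1 : ∑ i ∈ s, μ.real (f ⁻¹' {i}) = 1 := by
    rw [← hf.sum_measureReal (μ := μ)]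
    exact Finset.sum_subset (Finset.subset_univ _) fun i _ hi => h0 i hi
  have h2 : labelEnt μ f = ∑ i ∈ s, Real.negMulLog (μ.real (f ⁻¹' {i})) :=
    (Finset.sum_subset (Finset.subset_univ _) fun i _ hi => by simp [h0 i hi]).symm
  have hne : s.Nonempty := by
    by_contra h
    simp [Finset.not_nonempty_iff_eq_empty.1 h] at h1
  have hc : (0 : ℝ) < s.card := by exact_mod_cast hne.card_pos
  have h3 := Real.concaveOn_negMulLog.le_map_sum (t := s) (w := fun _ => (s.card : ℝ)⁻¹)
    (p := fun i => μ.real (f ⁻¹' {i})) (fun _ _ => by positivity)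
    (by simp [hc.ne']) (fun _ _ => measureReal_nonneg)
  simp only [smul_eq_mul, ← Finset.mul_sum, h1, ← h2, mul_one] at h3
  rw [Real.negMulLog, Real.log_inv, neg_mul_neg] at h3
  exact le_of_mul_le_mul_left h3 (by positivity)

lemma log_le_labelEnt {f : X → ι} (hf : MeasLabel f) {N : ℝ}
    (h : ∀ i, μ.real (f ⁻¹' {i}) ≤ N⁻¹) : Real.log N ≤ labelEnt μ f := by
  calc Real.log N = ∑ i, μ.real (f ⁻¹' {i}) * Real.log N := by
        rw [← Finset.sum_mul, hf.sum_measureReal, one_mul]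
    _ ≤ labelEnt μ f := by
        refine Finset.sum_le_sum fun i _ => ?_
        rcases (measureReal_nonneg (μ := μ) (s := f ⁻¹' {i})).eq_or_lt with h0 | h0
        · simp [← h0]
        · have := Real.log_le_log h0 (h i)
          rw [Real.log_inv] at this
          rw [Real.negMulLog, neg_mul, ← mul_neg]
          gcongr
          linarith

omit [IsProbabilityMeasure μ] in
lemma MeasureTheory.MeasurePreserving.labelEnt_comp {S : X → X} (hS : MeasurePreserving S μ μ)
    {f : X → ι} (hf : MeasLabel f) : labelEnt μ (fun x => f (S x)) = labelEnt μ f := by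
  refine Finset.sum_congr rfl fun i _ => ?_
  congr 1
  exact hS.measureReal_preimage (hf i).nullMeasurableSet

lemma labelEnt_itin_add_le {S : X → X} (hS : Measurable S) {f : X → ι} (hf : MeasLabel f)
    (m n : ℕ) : labelEnt μ (itin S f (m + n)) ≤
      labelEnt μ (itin S f m) + labelEnt μ (fun x => itin S f n (S^[m] x)) := by
  have h2 := (hf.itin hS n).comp_right (hS.iterate m)
  refine le_trans ?_ (labelEnt_prod_le (hf.itin hS m) h2)
  refine labelEnt_comp_le ((hf.itin hS m).prodMk h2) (fun p => Fin.append p.1 p.2) fun x => ?_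
  ext i
  refine Fin.addCases (fun i => ?_) (fun i => ?_) i
  · simp [itin]
  · simp [itin, add_comm m, Function.iterate_add_apply]

lemma labelEnt_itin_mono {S : X → X} (hS : Measurable S) {f : X → ι} (hf : MeasLabel f)
    {m n : ℕ} (hmn : m ≤ n) : labelEnt μ (itin S f m) ≤ labelEnt μ (itin S f n) :=
  labelEnt_comp_le (hf.itin hS n) (fun u i => u (Fin.castLE hmn i)) fun _ => rfl

lemma labelEnt_itin_le {S : X → X} (hS : Measurable S) {f : X → ι} (hf : MeasLabel f) (n : ℕ) :
    labelEnt μ (itin S f n) ≤ n * Real.log (Fintype.card ι) := by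
  have := labelEnt_le_log_card (μ := μ) (hf.itin hS n) Finset.univ (by simp)
  simpa using this

/-- The entropy of a finite labelling under a transformation. -/
noncomputable def labelRate (μ : Measure X) (S : X → X) (f : X → ι) : ℝ :=
  limUnder atTop fun n : ℕ => labelEnt μ (itin S f n) / n

lemma subadditive_labelEnt_itin {S : X → X} (hS : MeasurePreserving S μ μ) {f : X → ι}
    (hf : MeasLabel f) : Subadditive fun n => labelEnt μ (itin S f n) := by
  intro m n
  have := labelEnt_itin_add_le (μ := μ) hS.measurable hf m n
  rwa [(hS.iterate m).labelEnt_comp (hf.itin hS.measurable n)] at this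

lemma tendsto_labelRate {S : X → X} (hS : MeasurePreserving S μ μ) {f : X → ι}
    (hf : MeasLabel f) :
    Tendsto (fun n : ℕ => labelEnt μ (itin S f n) / n) atTop (𝓝 (labelRate μ S f)) := by
  refine tendsto_nhds_limUnder ⟨_, (subadditive_labelEnt_itin hS hf).tendsto_lim ⟨0, ?_⟩⟩
  rintro _ ⟨n, rfl⟩
  exact div_nonneg (labelEnt_nonneg _) n.cast_nonneg

/-- Windows of length `q` along the first `n` iterates carry `q` times the entropy of the
itinerary of length `n`, up to an error independent of `n`. -/
lemma mul_labelEnt_itin_le {S : X → X} (hS : Measurable S) {f : X → ι} (hf : MeasLabel f)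
    (q n : ℕ) : q * labelEnt μ (itin S f n) ≤
      ∑ i ∈ Finset.range n, labelEnt μ (fun x => itin S f q (S^[i] x)) +
        q * (q * Real.log (Fintype.card ι)) := by
  set h : ℕ → ℝ := fun n => labelEnt μ (itin S f n) with hh
  have h1 : ∑ i ∈ Finset.range n, (h (i + q) - h i) ≤
      ∑ i ∈ Finset.range n, labelEnt μ (fun x => itin S f q (S^[i] x)) := by
    refine Finset.sum_le_sum fun i _ => ?_
    linarith [labelEnt_itin_add_le (μ := μ) hS hf i q]
  have h2 : ∑ i ∈ Finset.range n, (h (i + q) - h i) =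
      ∑ i ∈ Finset.range q, h (n + i) - ∑ i ∈ Finset.range q, h i := by
    have e1 := Finset.sum_range_add h n q
    have e2 := Finset.sum_range_add h q n
    rw [add_comm q n] at e2
    simp only [Finset.sum_sub_distrib, add_comm _ q]
    linarith
  have h3 : q * h n ≤ ∑ i ∈ Finset.range q, h (n + i) := by
    simpa using Finset.card_nsmul_le_sum (Finset.range q) (fun i => h (n + i)) (h n)
      fun i _ => labelEnt_itin_mono hS hf (Nat.le_add_right n i)
  have h4 : ∑ i ∈ Finset.range q, h i ≤ q * (q * Real.log (Fintype.card ι)) := by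
    have := Finset.sum_le_card_nsmul (Finset.range q) h (q * Real.log (Fintype.card ι))
      fun i hi => (labelEnt_itin_mono hS hf (Finset.mem_range.1 hi).le).trans
        (labelEnt_itin_le hS hf q)
    simpa using this
  linarith

end Probability

end Shannon

section Covers

variable {Y : Type*}

lemma mem_joinN {S : Y → Y} {U : Finset (Set Y)} {n : ℕ} {A : Set Y} :
    A ∈ joinN S U n ↔ ∃ u : ℕ → Set Y, (∀ i < n, u i ∈ U) ∧ A = {x | ∀ i < n, S^[i] x ∈ u i} := by
  induction n generalizing A with
  | zero => simp [joinN]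
  | succ n ih =>
    simp only [joinN, cJoin, preC, Finset.mem_image, Finset.mem_product, Prod.exists]
    constructor
    · rintro ⟨_, _, ⟨hB, C, hC, rfl⟩, rfl⟩
      obtain ⟨u, hu, rfl⟩ := ih.1 hB
      refine ⟨fun i => if i = n then C else u i, fun i hi => ?_, ?_⟩
      · dsimp only
        split_ifs with h
        · exact hC
        · exact hu i (by omega)
      · ext x
        simp only [Set.mem_inter_iff, Set.mem_ofPred_eq, Set.mem_preimage]
        constructor
        · rintro ⟨h1, h2⟩ i hi
          split_ifs with h
          · exact h ▸ h2
          · exact h1 i (by omega)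
        · intro h
          refine ⟨fun i hi => ?_, by simpa using h n (by omega)⟩
          simpa [hi.ne] using h i (by omega)
    · rintro ⟨u, hu, rfl⟩
      refine ⟨_, _, ⟨ih.2 ⟨u, fun i hi => hu i (by omega), rfl⟩, u n, hu n (by omega), rfl⟩, ?_⟩
      ext x
      simp only [Set.mem_inter_iff, Set.mem_ofPred_eq, Set.mem_preimage, Nat.lt_succ_iff_lt_or_eq]
      constructor
      · rintro ⟨h1, h2⟩ i (hi | rfl)
        exacts [h1 i hi, h2]
      · exact fun h => ⟨fun i hi => h i (.inl hi), h n (.inr rfl)⟩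

lemma exists_mem_joinN {S : Y → Y} {U : Finset (Set Y)} (hU : ⋃₀ (U : Set (Set Y)) = Set.univ)
    (n : ℕ) (x : Y) : ∃ A ∈ joinN S U n, x ∈ A := by
  have h : ∀ y : Y, ∃ A ∈ U, y ∈ A := fun y => by
    simpa using (Set.ext_iff.1 hU y).2 trivial
  choose c hc hxc using h
  exact ⟨_, mem_joinN.2 ⟨fun i => c (S^[i] x), fun i _ => hc _, rfl⟩, fun i _ => hxc _⟩

lemma covNfull_le_card {V : Finset (Set Y)} {E : Type*} (s : Finset E) (φ : E → Set Y)
    (hφ : ∀ e ∈ s, φ e ∈ V) (hc : ∀ x, ∃ e ∈ s, x ∈ φ e) : covNfull V ≤ s.card := by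
  refine le_trans (Nat.sInf_le ⟨s.image φ, ?_, rfl, ?_⟩) Finset.card_image_le
  · exact Finset.image_subset_iff.2 hφ
  · ext x
    simpa using hc x

lemma exists_card_eq_covNfull {V : Finset (Set Y)} (hV : ∀ x, ∃ A ∈ V, x ∈ A) :
    ∃ W ⊆ V, W.card = covNfull V ∧ ∀ x, ∃ A ∈ W, x ∈ A := by
  have h : ⋃₀ (V : Set (Set Y)) = Set.univ := by ext x; simpa using hV x
  obtain ⟨W, hW, hc, hu⟩ := Nat.sInf_mem (s := {m | ∃ W ⊆ V, W.card = m ∧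
    ⋃₀ (W : Set (Set Y)) = Set.univ}) ⟨_, V, subset_rfl, rfl, h⟩
  exact ⟨W, hW, hc, fun x => by simpa using (Set.ext_iff.1 hu x).2 trivial⟩

lemma covNfull_pos [Nonempty Y] {V : Finset (Set Y)} (hV : ∀ x, ∃ A ∈ V, x ∈ A) :
    0 < covNfull V := by
  obtain ⟨W, -, hc, hx⟩ := exists_card_eq_covNfull hV
  obtain ⟨A, hA, -⟩ := hx (Classical.arbitrary Y)
  exact hc ▸ Finset.card_pos.2 ⟨A, hA⟩

lemma covNfull_le_of_refines {V W : Finset (Set Y)} (hV : ∀ x, ∃ A ∈ V, x ∈ A)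
    (h : ∀ A ∈ V, ∃ B ∈ W, A ⊆ B) : covNfull W ≤ covNfull V := by
  obtain ⟨V', hV', hc, hx⟩ := exists_card_eq_covNfull hV
  choose! φ hφ hsub using h
  rw [← hc]
  refine covNfull_le_card V' φ (fun A hA => hφ A (hV' hA)) fun x => ?_
  obtain ⟨A, hA, hxA⟩ := hx x
  exact ⟨A, hA, hsub A (hV' hA) hxA⟩

lemma covNfull_joinN_add_le {S : Y → Y} {U : Finset (Set Y)}
    (hU : ⋃₀ (U : Set (Set Y)) = Set.univ) (m n : ℕ) :
    covNfull (joinN S U (m + n)) ≤ covNfull (joinN S U m) * covNfull (joinN S U n) := by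
  obtain ⟨V, hV, hVc, hVx⟩ := exists_card_eq_covNfull (exists_mem_joinN (S := S) hU m)
  obtain ⟨W, hW, hWc, hWx⟩ := exists_card_eq_covNfull (exists_mem_joinN (S := S) hU n)
  rw [← hVc, ← hWc, ← Finset.card_product]
  refine covNfull_le_card _ (fun p => p.1 ∩ S^[m] ⁻¹' p.2) ?_ fun x => ?_
  · rintro ⟨A, B⟩ h
    obtain ⟨hA, hB⟩ := Finset.mem_product.1 h
    obtain ⟨u, hu, rfl⟩ := mem_joinN.1 (hV hA)
    obtain ⟨v, hv, rfl⟩ := mem_joinN.1 (hW hB)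
    refine mem_joinN.2 ⟨fun i => if i < m then u i else v (i - m), fun i hi => ?_, ?_⟩
    · dsimp only
      split_ifs with h
      · exact hu i h
      · exact hv _ (by omega)
    · ext x
      simp only [Set.mem_inter_iff, Set.mem_ofPred_eq, Set.mem_preimage]
      constructor
      · rintro ⟨h1, h2⟩ i hi
        split_ifs with h
        · exact h1 i h
        · have := h2 (i - m) (by omega)
          rwa [← Function.iterate_add_apply, Nat.sub_add_cancel (by omega)] at this
      · intro h
        refine ⟨fun i hi => by simpa [hi] using h i (by omega), fun i hi => ?_⟩
        have := h (i + m) (by omega)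
        simpa [Function.iterate_add_apply] using this
  · obtain ⟨A, hA, hxA⟩ := hVx x
    obtain ⟨B, hB, hxB⟩ := hWx (S^[m] x)
    exact ⟨(A, B), Finset.mem_product.2 ⟨hA, hB⟩, hxA, hxB⟩

/-- The topological entropy of an open cover. -/
noncomputable def coverRate (S : Y → Y) (U : Finset (Set Y)) : ℝ :=
  limUnder atTop fun n : ℕ => Real.log (covNfull (joinN S U n)) / n

lemma tendsto_coverRate [Nonempty Y] {S : Y → Y} {U : Finset (Set Y)}
    (hU : ⋃₀ (U : Set (Set Y)) = Set.univ) :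
    Tendsto (fun n : ℕ => Real.log (covNfull (joinN S U n)) / n) atTop (𝓝 (coverRate S U)) := by
  have hpos : ∀ n, (0 : ℝ) < covNfull (joinN S U n) := fun n => by
    exact_mod_cast covNfull_pos (exists_mem_joinN hU n)
  have hs : Subadditive fun n => Real.log (covNfull (joinN S U n)) := by
    intro m n
    rw [← Real.log_mul (hpos m).ne' (hpos n).ne']
    exact Real.log_le_log (hpos _) (by exact_mod_cast covNfull_joinN_add_le hU m n)
  refine tendsto_nhds_limUnder ⟨_, hs.tendsto_lim ⟨0, ?_⟩⟩
  rintro _ ⟨n, rfl⟩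
  exact div_nonneg (Real.log_natCast_nonneg _) n.cast_nonneg

variable {ι : Type*} [Fintype ι]

/-- The finite family of fibres of a labelling. -/
noncomputable def fibres (f : Y → ι) : Finset (Set Y) := Finset.univ.image fun i => f ⁻¹' {i}

lemma joinN_fibres (S : Y → Y) (f : Y → ι) (n : ℕ) :
    joinN S (fibres f) n = fibres (itin S f n) := by
  ext A
  simp only [mem_joinN, fibres, Finset.mem_image, Finset.mem_univ, true_and]
  constructor
  · rintro ⟨u, hu, rfl⟩
    choose c hc using hu
    refine ⟨fun i => c i i.2, ?_⟩
    ext x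
    simp only [itin, Set.mem_preimage, Set.mem_singleton_iff, funext_iff, Set.mem_ofPred_eq,
      Fin.forall_iff]
    refine forall₂_congr fun i hi => ?_
    rw [← hc i hi]; rfl
  · rintro ⟨c, rfl⟩
    refine ⟨fun i => if h : i < n then f ⁻¹' {c ⟨i, h⟩} else ∅, fun i hi => ⟨c ⟨i, hi⟩, ?_⟩, ?_⟩
    · simp [hi]
    · ext x
      simp only [itin, Set.mem_preimage, Set.mem_singleton_iff, funext_iff, Set.mem_ofPred_eq,
        Fin.forall_iff]
      refine forall₂_congr fun i hi => ?_
      simp [hi]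

lemma entPart_fibres (μ : Measure X) (f : X → ι) : entPart μ (fibres f) = labelEnt μ f := by
  rw [entPart, fibres, Finset.sum_image_of_pairwise_eq_zero]
  · rfl
  · intro i _ j _ hij h
    have : f ⁻¹' {i} = ∅ := by
      have hd : Disjoint (f ⁻¹' {i}) (f ⁻¹' {j}) := Disjoint.preimage _ (by simpa using hij)
      rw [← h] at hd
      exact disjoint_self.1 hd
    simp [this]

lemma hPart_fibres (μ : Measure X) (S : X → X) (f : X → ι) :
    hPart μ S (fibres f) = labelRate μ S f := by
  simp only [hPart, joinN_fibres, entPart_fibres, labelRate]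

lemma isMPartition_fibres {f : X → ι} (hf : MeasLabel f) : IsMPartition (fibres f) := by
  refine ⟨⟨?_, ?_⟩, ?_⟩
  · intro A hA
    obtain ⟨i, -, rfl⟩ := Finset.mem_image.1 hA
    exact hf i
  · ext x
    simp [fibres]
  · intro A hA B hB hAB
    obtain ⟨i, -, rfl⟩ := Finset.mem_image.1 hA
    obtain ⟨j, -, rfl⟩ := Finset.mem_image.1 hB
    have : i ≠ j := fun h => hAB (h ▸ rfl)
    exact Disjoint.preimage _ (by simpa using this)

lemma ofReal_labelRate_le_hKS {μ : Measure X} {S : X → X} {f : X → ι} (hf : MeasLabel f) :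
    ENNReal.ofReal (labelRate μ S f) ≤ hKS μ S := by
  rw [← hPart_fibres]
  exact le_iSup (fun α : {α : Finset (Set X) // IsMPartition α} =>
    ENNReal.ofReal (hPart μ S (↑α))) ⟨_, isMPartition_fibres hf⟩

lemma IsMPartition.exists_fibres_eq {α : Finset (Set X)} (hα : IsMPartition α) :
    ∃ f : X → α, MeasLabel f ∧ fibres f = α := by
  have h : ∀ y : X, ∃ A : α, y ∈ (A : Set X) := fun y => by
    simpa using (Set.ext_iff.1 hα.1.2 y).2 trivial
  choose f hf using h
  have hA : ∀ A : α, f ⁻¹' {A} = A := by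
    intro A
    ext x
    refine ⟨?_, fun hx => ?_⟩
    · rintro rfl
      exact hf x
    · by_contra hne
      exact (hα.2 _ (f x).2 _ A.2 fun h => hne (Subtype.ext h)).le_bot ⟨hf x, hx⟩
  refine ⟨f, fun A => ?_, ?_⟩
  · rw [hA]; exact hα.1.1 A A.2
  · ext B
    simp [fibres, hA]

end Covers

section UpperBound

variable {ι κ : Type*} [Fintype ι] [Fintype κ]

lemma labelEnt_prod_add_le_of_factor {ι' : Type*} [Fintype ι'] {μ : Measure X}
    [IsProbabilityMeasure μ] {f : X → ι} {g : X → ι'} {h : X → κ}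
    (hf : MeasLabel f) (hg : MeasLabel g) (φ : ι' → κ) (hφ : ∀ x, h x = φ (g x)) :
    labelEnt μ (fun x => (f x, g x)) + labelEnt μ h ≤
      labelEnt μ (fun x => (f x, h x)) + labelEnt μ g := by
  have hh : MeasLabel h := by
    rw [funext hφ]
    exact hg.comp_left φ
  have h1 := labelEnt_prod_add_le (μ := μ) hf hg hh
  have h2 := labelEnt_comp_le (μ := μ) hg (g := fun x => (g x, h x)) (fun i => (i, φ i))
    fun x => by rw [hφ]
  have h3 := labelEnt_comp_le (μ := μ) (hf.prodMk (hg.prodMk hh)) (g := fun x => (f x, g x))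
    (fun p => (p.1, p.2.1)) fun _ => rfl
  linarith

lemma labelEnt_itin_le_add {μ : Measure X} [IsProbabilityMeasure μ] {S : X → X}
    (hS : MeasurePreserving S μ μ) {f : X → ι} {g : X → κ} (hf : MeasLabel f) (hg : MeasLabel g)
    {c : ℝ} (hc : labelEnt μ (fun x => (f x, g x)) ≤ labelEnt μ g + c) (n : ℕ) :
    labelEnt μ (fun x => (itin S f n x, itin S g n x)) ≤ labelEnt μ (itin S g n) + n * c := by
  have hSm := hS.measurable
  have hitin {ι : Type _} {f : X → ι} (n : ℕ) (x : X) :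
      itin S f (n + 1) x = Fin.snoc (itin S f n x) (f (S^[n] x)) := by
    ext i
    refine Fin.lastCases ?_ (fun i => ?_) i <;> simp [itin]
  induction n with
  | zero =>
    have := labelEnt_comp_le (μ := μ) (hg.itin hSm 0) (g := fun x => (itin S f 0 x, itin S g 0 x))
      (fun u => (Fin.elim0, u)) fun x => Prod.ext (Subsingleton.elim _ _) rfl
    simpa using this
  | succ n ih =>
    have hfn := hf.comp_right (hSm.iterate n)
    have hgn := hg.comp_right (hSm.iterate n)
    have hg1 := hg.itin hSm (n + 1)
    have h1 := labelEnt_prod_add_le (μ := μ) (hf.itin hSm n) hfn hg1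
    have h2 := labelEnt_prod_add_le_of_factor (μ := μ) (hf.itin hSm n) hg1
      (h := itin S g n) (fun u i => u i.castSucc) fun x => rfl
    have h3 := labelEnt_prod_add_le_of_factor (μ := μ) hfn hg1
      (h := fun x => g (S^[n] x)) (fun u => u (Fin.last n)) fun x => rfl
    have h4 := labelEnt_comp_le (μ := μ) ((hf.itin hSm n).prodMk (hfn.prodMk hg1))
      (g := fun x => (itin S f (n + 1) x, itin S g (n + 1) x))
      (fun p => (Fin.snoc p.1 p.2.1, p.2.2)) fun x => by rw [hitin]
    have h5 := (hS.iterate n).labelEnt_comp (hf.prodMk hg)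
    have h6 := (hS.iterate n).labelEnt_comp hg
    push_cast
    linarith

variable {Z : Type*} [MetricSpace Z] [CompactSpace Z] [Nonempty Z] [MeasurableSpace Z]
  [BorelSpace Z]

lemma exists_openCover_labelEnt_itin_le {μ : Measure Z} [IsProbabilityMeasure μ] {S : Z → Z}
    (hS : MeasurePreserving S μ μ) {f : Z → ι} (hf : MeasLabel f) :
    ∃ U : Finset (Set Z), (∀ A ∈ U, IsOpen A) ∧ ⋃₀ (U : Set (Set Z)) = Set.univ ∧
      ∀ n, labelEnt μ (itin S f n) ≤ Real.log (covNfull (joinN S U n)) + n * 2 := by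
  have hne : Nonempty ι := (inferInstance : Nonempty Z).map f
  have hm : (0 : ℝ) < Fintype.card ι := by exact_mod_cast Fintype.card_pos
  obtain ⟨δ, hδ, hη⟩ : ∃ δ > 0, ∀ x : ℝ, 0 ≤ x → x < δ →
      Real.negMulLog x ≤ (Fintype.card ι : ℝ)⁻¹ := by
    have := Real.continuous_negMulLog.continuousAt (x := 0)
    obtain ⟨δ, hδ, h⟩ := Metric.continuousAt_iff.1 this _ (inv_pos.2 hm)
    refine ⟨δ, hδ, fun x h0 hx => ?_⟩
    have := h (x := x) (by simpa [abs_of_nonneg h0] using hx)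
    rw [Real.negMulLog_zero, Real.dist_eq, sub_zero] at this
    exact (le_abs_self _).trans this.le
  have hK : ∀ i, ∃ K ⊆ f ⁻¹' {i}, IsClosed K ∧ μ (f ⁻¹' {i} \ K) < ENNReal.ofReal δ := fun i =>
    (hf i).exists_isClosed_sdiff_lt (measure_ne_top _ _) (by simpa using hδ)
  choose K hKf hKc hKμ using hK
  set g : Z → Option ι := fun x => if x ∈ K (f x) then some (f x) else none with hgdef
  have hgs : ∀ x i, g x = some i ↔ x ∈ K i := by
    intro x i
    simp only [hgdef]
    split_ifs with h
    · refine ⟨fun e => Option.some_injective _ e ▸ h, fun h' => ?_⟩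
      rw [show f x = i from hKf i h']
    · refine ⟨fun e => by simp at e, fun h' => ?_⟩
      rw [show f x = i from hKf i h'] at h
      exact absurd h' h
  have hgK : ∀ i, g ⁻¹' {some i} = K i := fun i => by ext x; simp [hgs]
  have hgm : MeasLabel g := by
    rintro (_ | i)
    · have : g ⁻¹' {none} = (⋃ i, K i)ᶜ := by
        ext x
        simp [Option.eq_none_iff_forall_ne_some, hgs]
      rw [this]
      exact (MeasurableSet.iUnion fun i => (hKc i).measurableSet).compl
    · rw [hgK]
      exact (hKc i).measurableSet
  have hcond : labelEnt μ (fun x => (f x, g x)) ≤ labelEnt μ g + 1 := by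
    have e1 : ∀ i, (fun x => (f x, g x)) ⁻¹' {(i, none)} = f ⁻¹' {i} \ K i := by
      intro i
      ext x
      simp only [Set.mem_preimage, Set.mem_singleton_iff, Prod.mk.injEq, Set.mem_sdiff]
      refine and_congr_right fun h => ?_
      subst h
      simp [hgdef]
    have e2 : ∀ i j, μ.real ((fun x => (f x, g x)) ⁻¹' {(i, some j)}) =
        if i = j then μ.real (K j) else 0 := by
      intro i j
      have : (fun x => (f x, g x)) ⁻¹' {(i, some j)} = if i = j then K j else ∅ := by
        ext x
        simp only [Set.mem_preimage, Set.mem_singleton_iff, Prod.mk.injEq, hgs]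
        split_ifs with h
        · subst h
          exact ⟨fun h => h.2, fun h => ⟨hKf _ h, h⟩⟩
        · simp only [Set.mem_empty_iff_false, iff_false, not_and]
          exact fun h1 h2 => h (h1.symm.trans (hKf _ h2))
      rw [this]
      split_ifs <;> simp
    have e3 : ∑ i, Real.negMulLog (μ.real (f ⁻¹' {i} \ K i)) ≤ 1 := by
      calc _ ≤ ∑ i : ι, (Fintype.card ι : ℝ)⁻¹ := by
            refine Finset.sum_le_sum fun i _ => hη _ measureReal_nonneg ?_
            exact (ENNReal.lt_ofReal_iff_toReal_lt (measure_ne_top _ _)).1 (hKμ i)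
        _ = 1 := by simp [hm.ne']
    have e4 : 0 ≤ Real.negMulLog (μ.real (g ⁻¹' {none})) :=
      Real.negMulLog_nonneg measureReal_nonneg measureReal_le_one
    have e5 : ∀ i, ∑ j, Real.negMulLog (if i = j then μ.real (K j) else 0) =
        Real.negMulLog (μ.real (K i)) := by
      intro i
      rw [Finset.sum_eq_single i] <;> simp +contextual [eq_comm]
    simp only [labelEnt, Fintype.sum_prod_type, Fintype.sum_option, e1, e2, hgK,
      Finset.sum_add_distrib, e5]
    linarith
  set V : ι → Set Z := fun j => {x | g x = none ∨ g x = some j} with hV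
  have hVo : ∀ j, IsOpen (V j) := by
    intro j
    have : V j = (⋃ i ∈ {i | i ≠ j}, K i)ᶜ := by
      ext x
      simp only [hV, Set.mem_ofPred_eq, Set.mem_compl_iff, Set.mem_iUnion, ← hgs]
      rcases g x with _ | i <;> simp
    rw [this]
    exact ((Set.toFinite _).isClosed_biUnion fun i _ => hKc i).isOpen_compl
  have hVU : ⋃₀ ((Finset.univ.image V : Finset (Set Z)) : Set (Set Z)) = Set.univ := by
    ext x
    simp only [Finset.coe_image, Finset.coe_univ, Set.image_univ, Set.sUnion_range,
      Set.mem_iUnion, Set.mem_univ, iff_true]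
    refine ⟨f x, ?_⟩
    simp only [hV, hgdef, Set.mem_ofPred_eq]
    split_ifs <;> simp
  refine ⟨Finset.univ.image V, ?_, hVU, fun n => ?_⟩
  · intro A hA
    obtain ⟨j, -, rfl⟩ := Finset.mem_image.1 hA
    exact hVo j
  obtain ⟨W, hW, hWc, hWx⟩ := exists_card_eq_covNfull (exists_mem_joinN (S := S) hVU n)
  have hj : ∀ A ∈ W, ∃ j : Fin n → ι, ∀ x ∈ A, ∀ i : Fin n, S^[i] x ∈ V (j i) := by
    intro A hA
    obtain ⟨u, hu, rfl⟩ := mem_joinN.1 (hW hA)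
    have : ∀ i : Fin n, ∃ j, V j = u i := fun i => by simpa using hu i i.2
    choose j hj using this
    exact ⟨j, fun x hx i => hj i ▸ hx i i.2⟩
  choose! j hj using hj
  set s : Finset (Fin n → Option ι) := W.biUnion fun A =>
    Finset.univ.image fun b : Fin n → Bool => fun i => if b i then some (j A i) else none with hs
  have hsc : s.card ≤ covNfull (joinN S (Finset.univ.image V) n) * 2 ^ n := by
    rw [← hWc]
    refine Finset.card_biUnion_le_card_mul _ _ _ fun A _ => ?_
    exact Finset.card_image_le.trans (by simp)
  have hsg : ∀ x, itin S g n x ∈ s := by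
    intro x
    obtain ⟨A, hA, hxA⟩ := hWx x
    refine Finset.mem_biUnion.2 ⟨A, hA, Finset.mem_image.2
      ⟨fun i => decide (g (S^[i] x) = some (j A i)), Finset.mem_univ _, ?_⟩⟩
    ext1 i
    have := hj A hA x hxA i
    simp only [hV, Set.mem_ofPred_eq] at this
    rcases this with h | h <;> simp [itin, h]
  have hSm := hS.measurable
  have h1 := labelEnt_le_log_card (μ := μ) (hgm.itin hSm n) s hsg
  have hpos : (0 : ℝ) < covNfull (joinN S (Finset.univ.image V) n) := by
    exact_mod_cast covNfull_pos (exists_mem_joinN hVU n)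
  have hspos : 0 < s.card := Finset.card_pos.2 ⟨_, hsg (Classical.arbitrary Z)⟩
  have h2 : Real.log s.card ≤
      Real.log (covNfull (joinN S (Finset.univ.image V) n)) + n * Real.log 2 := by
    rw [← Real.log_pow, ← Real.log_mul hpos.ne' (by positivity)]
    exact Real.log_le_log (by exact_mod_cast hspos) (by exact_mod_cast hsc)
  have h3 := labelEnt_itin_le_add hS hf hgm hcond n
  have h4 := labelEnt_comp_le (μ := μ) ((hf.itin hSm n).prodMk (hgm.itin hSm n))
    (g := itin S f n) Prod.fst fun _ => rfl
  have h5 : n * Real.log 2 ≤ n * 1 := by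
    gcongr
    linarith [Real.log_two_lt_d9]
  linarith

omit [MetricSpace Z] [CompactSpace Z] [Nonempty Z] [MeasurableSpace Z] [BorelSpace Z] in
lemma covNfull_joinN_iterate_le {S : Z → Z} {U : Finset (Set Z)}
    (hU : ⋃₀ (U : Set (Set Z)) = Set.univ) {k : ℕ} (hk : 0 < k) (n : ℕ) :
    covNfull (joinN (S^[k]) U n) ≤ covNfull (joinN S U (n * k)) := by
  refine covNfull_le_of_refines (exists_mem_joinN hU _) fun A hA => ?_
  obtain ⟨u, hu, rfl⟩ := mem_joinN.1 hA
  have hlt : ∀ i < n, k * i < n * k := fun i hi => by rw [mul_comm]; gcongr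
  refine ⟨_, mem_joinN.2 ⟨fun i => u (k * i), fun i hi => hu _ (hlt i hi), rfl⟩,
    fun x hx i hi => ?_⟩
  rw [← Function.iterate_mul]
  exact hx _ (hlt i hi)

lemma exists_openCover_labelRate_le {μ : Measure Z} [IsProbabilityMeasure μ] {S : Z → Z}
    (hS : MeasurePreserving S μ μ) {f : Z → ι} (hf : MeasLabel f) {k : ℕ} (hk : 0 < k) :
    ∃ U : Finset (Set Z), (∀ A ∈ U, IsOpen A) ∧ ⋃₀ (U : Set (Set Z)) = Set.univ ∧
      labelRate μ S f ≤ coverRate S U + 2 / k := by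
  obtain ⟨U, hUo, hU, h⟩ :=
    exists_openCover_labelEnt_itin_le (hS.iterate k) (hf.itin hS.measurable k)
  refine ⟨U, hUo, hU, ?_⟩
  have ht : Tendsto (fun n : ℕ => n * k) atTop atTop := tendsto_id.atTop_mul_const' hk
  have h1 := (tendsto_labelRate hS hf).comp ht
  have h2 := ((tendsto_coverRate (S := S) hU).comp ht).add_const (2 / k : ℝ)
  refine le_of_tendsto_of_tendsto h1 h2 ?_
  filter_upwards [eventually_gt_atTop 0] with n hn
  have hn' : (0 : ℝ) < n := by exact_mod_cast hn
  have hk' : (0 : ℝ) < k := by exact_mod_cast hk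
  have h3 := labelEnt_comp_le (μ := μ)
    ((hf.itin hS.measurable k).itin (hS.iterate k).measurable n) (g := itin S f (n * k))
    (fun u i => u i.divNat i.modNat) fun x => by
      ext i
      simp only [itin, ← Function.iterate_mul, ← Function.iterate_add_apply, Fin.coe_divNat,
        Fin.coe_modNat, Nat.mod_add_div]
  have h4 : Real.log (covNfull (joinN (S^[k]) U n)) ≤ Real.log (covNfull (joinN S U (n * k))) :=
    Real.log_le_log (by exact_mod_cast covNfull_pos (exists_mem_joinN hU n))
      (by exact_mod_cast covNfull_joinN_iterate_le hU hk n)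
  have h5 := h n
  simp only [Function.comp_apply]
  rw [show (2 / k : ℝ) = n * 2 / (n * k : ℕ) by push_cast; field_simp, ← add_div]
  gcongr
  linarith

lemma hKS_le_hTop {μ : Measure Z} [IsProbabilityMeasure μ] {S : Z → Z}
    (hS : MeasurePreserving S μ μ) : hKS μ S ≤ hTop S := by
  refine iSup_le ?_
  rintro ⟨α, hα⟩
  obtain ⟨f, hf, hfα⟩ := hα.exists_fibres_eq
  have hrate : hPart μ S α = labelRate μ S f := by rw [← hPart_fibres, hfα]
  simp only [hrate]
  by_cases htop : hTop S = ⊤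
  · simp [htop]
  refine ENNReal.ofReal_le_of_le_toReal ?_
  have hk : ∀ k : ℕ, labelRate μ S f ≤ (hTop S).toReal + 2 / ((k + 1 : ℕ) : ℝ) := by
    intro k
    obtain ⟨U, hUo, hU, h⟩ := exists_openCover_labelRate_le hS hf k.succ_pos
    refine h.trans ?_
    gcongr
    refine (ENNReal.ofReal_le_iff_le_toReal htop).1 ?_
    exact le_iSup (fun U : {U : Finset (Set Z) // (∀ A ∈ U, IsOpen A) ∧
      ⋃₀ (U : Set (Set Z)) = Set.univ} => ENNReal.ofReal (coverRate S U)) ⟨U, hUo, hU⟩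
  have ht : Tendsto (fun k : ℕ => (hTop S).toReal + 2 / ((k + 1 : ℕ) : ℝ)) atTop
      (𝓝 ((hTop S).toReal + 0)) :=
    ((tendsto_const_div_atTop_nhds_zero_nat 2).comp (tendsto_add_atTop_nat 1)).const_add _
  rw [add_zero] at ht
  exact ge_of_tendsto' ht hk

end UpperBound

section BallLabels

variable {Z : Type*} [MetricSpace Z]

/-- The labelling recording which of the balls of radius `t` about points of `s` contain a
given point. -/
noncomputable def ballLabel (s : Finset Z) (t : ℝ) (x : Z) : s → Bool :=
  fun c => decide (dist x c < t)

lemma dist_lt_of_ballLabel_eq {s : Finset Z} {t : ℝ} (hs : ∀ x, ∃ c ∈ s, dist x c < t) {x y : Z}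
    (h : ballLabel s t x = ballLabel s t y) : dist x y < 2 * t := by
  obtain ⟨c, hc, hxc⟩ := hs x
  have := congrFun h ⟨c, hc⟩
  simp only [ballLabel, decide_eq_decide] at this
  linarith [dist_triangle_right x y c, this.1 hxc]

lemma itin_ballLabel_eventuallyEq {S : Z → Z} (hS : Continuous S) {s : Finset Z} {t : ℝ} {n : ℕ}
    {x : Z} (hx : ∀ i < n, ∀ c ∈ s, dist (S^[i] x) c ≠ t) :
    ∀ᶠ y in 𝓝 x, itin S (ballLabel s t) n y = itin S (ballLabel s t) n x := by
  have : ∀ i : Fin n, ∀ c : s, ∀ᶠ y in 𝓝 x,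
      itin S (ballLabel s t) n y i c = itin S (ballLabel s t) n x i c := by
    intro i c
    have hc : Continuous fun y => dist (S^[i] y) c := (hS.iterate i).dist continuous_const
    simp only [itin, ballLabel, decide_eq_decide]
    rcases (hx i i.2 c c.2).lt_or_gt with h | h
    · filter_upwards [hc.continuousAt.eventually_lt_const h] with y hy
      simp [hy, h]
    · filter_upwards [hc.continuousAt.eventually_const_lt h] with y hy
      exact iff_of_false hy.not_gt h.not_gt
  filter_upwards [eventually_all.2 fun i => eventually_all.2 (this i)] with y hy
  ext i c
  exact hy i c

lemma frontier_itin_ballLabel_subset {S : Z → Z} (hS : Continuous S) (s : Finset Z) (t : ℝ)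
    (n : ℕ) (A : Set (Fin n → s → Bool)) :
    frontier (itin S (ballLabel s t) n ⁻¹' A) ⊆
      ⋃ i : Fin n, ⋃ c : s, {x | dist (S^[i] x) c = t} := by
  intro x hx
  by_contra h
  simp only [Set.mem_iUnion, Set.mem_ofPred_eq, not_exists] at h
  have hev := itin_ballLabel_eventuallyEq hS (s := s) (t := t) (n := n) (x := x)
    fun i hi c hc => h ⟨i, hi⟩ ⟨c, hc⟩
  rw [frontier_eq_closure_inter_closure] at hx
  obtain ⟨y, hy, hyA⟩ := (mem_closure_iff_frequently.1 hx.1).and_eventually hev |>.exists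
  obtain ⟨z, hz, hzA⟩ := (mem_closure_iff_frequently.1 hx.2).and_eventually hev |>.exists
  rw [Set.mem_preimage, hyA] at hy
  rw [Set.mem_compl_iff, Set.mem_preimage, hzA] at hz
  exact hz hy

variable [MeasurableSpace Z] [BorelSpace Z]

lemma measLabel_ballLabel (s : Finset Z) (t : ℝ) : MeasLabel (ballLabel s t) := by
  refine MeasLabel.pi (f := fun (c : s) x => ballLabel s t x c) fun c b => ?_
  have h : MeasurableSet {x | dist x (c : Z) < t} :=
    (isOpen_lt (continuous_id.dist continuous_const) continuous_const).measurableSet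
  cases b
  · convert h.compl using 1
    ext x; simp [ballLabel]
  · convert h using 1
    ext x; simp [ballLabel]

lemma measurable_labelEnt_itin_ballLabel {S : Z → Z} (hS : Continuous S) (s : Finset Z) (n : ℕ)
    (μ : Measure Z) [IsFiniteMeasure μ] :
    Measurable fun t : ℝ => labelEnt μ (itin S (ballLabel s t) n) := by
  refine Finset.measurable_sum _ fun u _ => Real.continuous_negMulLog.measurable.comp ?_
  have hE : MeasurableSet {p : ℝ × Z | itin S (ballLabel s p.1) n p.2 = u} := by
    have : {p : ℝ × Z | itin S (ballLabel s p.1) n p.2 = u} =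
        ⋂ i : Fin n, ⋂ c : s, {p : ℝ × Z | decide (dist (S^[i] p.2) c < p.1) = u i c} := by
      ext p
      simp [itin, ballLabel, funext_iff]
    rw [this]
    refine MeasurableSet.iInter fun i => MeasurableSet.iInter fun c => ?_
    have h : MeasurableSet {p : ℝ × Z | dist (S^[i] p.2) (c : Z) < p.1} := by
      refine measurableSet_lt ?_ measurable_fst
      exact (((hS.iterate i).dist continuous_const).measurable).comp measurable_snd
    cases u i c
    · convert h.compl using 1
      ext x; simp
    · convert h using 1
      ext x; simp
  exact (measurable_measure_prodMk_left (ν := μ) hE).ennreal_toReal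

/-- The mean over random radii of the entropy of itineraries of length `n`. -/
noncomputable def avgEnt (P : Measure ℝ) (S : Z → Z) (s : Finset Z) (n : ℕ) (μ : Measure Z) : ℝ :=
  ∫ t, labelEnt μ (itin S (ballLabel s t) n) ∂P

/-- The mean over random radii of the entropy of the labelling by balls. -/
noncomputable def avgRate (P : Measure ℝ) (S : Z → Z) (s : Finset Z) (μ : Measure Z) : ℝ :=
  ∫ t, labelRate μ S (ballLabel s t) ∂P

variable {P : Measure ℝ} [IsProbabilityMeasure P] {S : Z → Z} {s : Finset Z}

lemma norm_labelEnt_itin_ballLabel_le (hS : Continuous S) (μ : Measure Z)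
    [IsProbabilityMeasure μ] (n : ℕ) (t : ℝ) :
    ‖labelEnt μ (itin S (ballLabel s t) n)‖ ≤ n * Real.log (Fintype.card (s → Bool)) := by
  rw [Real.norm_of_nonneg (labelEnt_nonneg _)]
  exact labelEnt_itin_le hS.measurable (measLabel_ballLabel s t) n

lemma integrable_labelEnt_itin_ballLabel (hS : Continuous S) (μ : Measure Z)
    [IsProbabilityMeasure μ] (n : ℕ) :
    Integrable (fun t => labelEnt μ (itin S (ballLabel s t) n)) P :=
  .of_bound (measurable_labelEnt_itin_ballLabel hS s n μ).aestronglyMeasurable _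
    (.of_forall (norm_labelEnt_itin_ballLabel_le hS μ n))

omit [BorelSpace Z] [IsProbabilityMeasure P] in
lemma avgEnt_nonneg (μ : Measure Z) [IsProbabilityMeasure μ] (n : ℕ) : 0 ≤ avgEnt P S s n μ :=
  integral_nonneg fun _ => labelEnt_nonneg _

lemma tendsto_avgRate (hS : Continuous S) {μ : Measure Z} [IsProbabilityMeasure μ]
    (hμ : MeasurePreserving S μ μ) :
    Tendsto (fun n : ℕ => avgEnt P S s n μ / n) atTop (𝓝 (avgRate P S s μ)) := by
  simp only [avgEnt, ← integral_div]
  refine tendsto_integral_of_dominated_convergence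
    (fun _ => Real.log (Fintype.card (s → Bool)))
    (fun n => ((measurable_labelEnt_itin_ballLabel hS s n μ).div_const _).aestronglyMeasurable)
    (integrable_const _) (fun n => .of_forall fun t => ?_)
    (.of_forall fun t => tendsto_labelRate hμ (measLabel_ballLabel s t))
  rw [norm_div, Real.norm_natCast]
  exact div_le_of_le_mul₀ n.cast_nonneg (Real.log_natCast_nonneg _)
    ((norm_labelEnt_itin_ballLabel_le hS μ n t).trans_eq (mul_comm _ _))

lemma avgRate_le_div (hS : Continuous S) {μ : Measure Z} [IsProbabilityMeasure μ]
    (hμ : MeasurePreserving S μ μ) {n : ℕ} (hn : n ≠ 0) :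
    avgRate P S s μ ≤ avgEnt P S s n μ / n := by
  have hsub : Subadditive fun n => avgEnt P S s n μ := by
    intro m n
    simp only [avgEnt]
    rw [← integral_add (integrable_labelEnt_itin_ballLabel hS μ m)
      (integrable_labelEnt_itin_ballLabel hS μ n)]
    exact integral_mono (integrable_labelEnt_itin_ballLabel hS μ _)
      ((integrable_labelEnt_itin_ballLabel hS μ m).add
        (integrable_labelEnt_itin_ballLabel hS μ n))
      fun t => subadditive_labelEnt_itin hμ (measLabel_ballLabel s t) m n
  have hb : BddBelow (Set.range fun n : ℕ => avgEnt P S s n μ / n) := by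
    refine ⟨0, ?_⟩
    rintro _ ⟨n, rfl⟩
    exact div_nonneg (avgEnt_nonneg μ n) n.cast_nonneg
  rw [tendsto_nhds_unique (tendsto_avgRate hS hμ) (hsub.tendsto_lim hb)]
  exact hsub.lim_le_div hb hn

lemma avgRate_le_of_forall_labelRate_le (hS : Continuous S) {μ : Measure Z} [IsProbabilityMeasure μ]
    (hμ : MeasurePreserving S μ μ) {h : ℝ} (hh : ∀ t, labelRate μ S (ballLabel s t) ≤ h) :
    avgRate P S s μ ≤ h := by
  have hintegral : Integrable (fun t => labelRate μ S (ballLabel s t)) P := by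
    refine .of_bound (C := Real.log (Fintype.card (s → Bool))) ?_ (.of_forall fun t => ?_)
    · exact aestronglyMeasurable_of_tendsto_ae atTop
        (fun n : ℕ => ((measurable_labelEnt_itin_ballLabel hS s n μ).div_const
          (n : ℝ)).aestronglyMeasurable)
        (.of_forall fun t => tendsto_labelRate hμ (measLabel_ballLabel s t))
    · refine le_of_tendsto (tendsto_labelRate hμ (measLabel_ballLabel s t)).norm
        (.of_forall fun n => ?_)
      rw [norm_div, Real.norm_natCast]
      exact div_le_of_le_mul₀ n.cast_nonneg (Real.log_natCast_nonneg _)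
        ((norm_labelEnt_itin_ballLabel_le hS μ n t).trans_eq (mul_comm _ _))
  calc avgRate P S s μ ≤ ∫ _, h ∂P := integral_mono hintegral (integrable_const _) hh
    _ = h := by simp

lemma continuous_avgEnt [CompactSpace Z] (hP : P ≪ volume) (hS : Continuous S) (n : ℕ) :
    Continuous fun μ : ProbabilityMeasure Z => avgEnt P S s n μ := by
  refine continuous_iff_continuousAt.2 fun μ => ?_
  refine tendsto_integral_filter_of_dominated_convergence
    (fun _ => n * Real.log (Fintype.card (s → Bool)))
    (.of_forall fun ν => (measurable_labelEnt_itin_ballLabel hS s n ν).aestronglyMeasurable)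
    (.of_forall fun ν => .of_forall (norm_labelEnt_itin_ballLabel_le hS ν n))
    (integrable_const _) ?_
  have hnull : ∀ᵐ t ∂P, ∀ i : Fin n, ∀ c : s,
      (μ : Measure Z) {x | dist (S^[i] x) (c : Z) = t} = 0 := by
    refine hP.ae_le (ae_all_iff.2 fun i => ae_all_iff.2 fun c => ?_)
    have hm : Measurable fun x => dist (S^[i] x) (c : Z) :=
      ((hS.iterate i).dist continuous_const).measurable
    have h0 := (Measure.countable_meas_level_set_pos (μ := (μ : Measure Z)) hm).measure_zero
      volume
    rw [ae_iff]
    simpa only [pos_iff_ne_zero] using h0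
  filter_upwards [hnull] with t ht
  refine tendsto_finsetSum _ fun u _ => ?_
  refine (Real.continuous_negMulLog.tendsto _).comp ?_
  refine (ENNReal.tendsto_toReal (measure_ne_top _ _)).comp ?_
  refine ProbabilityMeasure.tendsto_measure_of_null_frontier_of_tendsto' tendsto_id ?_
  refine measure_mono_null (frontier_itin_ballLabel_subset hS s t n {u}) ?_
  exact measure_iUnion_null fun i => measure_iUnion_null fun c => ht i c

lemma avgEnt_le_add (hS : Continuous S) {μ ν₁ ν₂ : Measure Z} [IsProbabilityMeasure μ]
    [IsProbabilityMeasure ν₁] [IsProbabilityMeasure ν₂] {a b : ℝ} (ha : 0 ≤ a) (hb : 0 ≤ b)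
    (h : ∀ A, MeasurableSet A → μ.real A = a * ν₁.real A + b * ν₂.real A) (n : ℕ) :
    avgEnt P S s n μ ≤ a * avgEnt P S s n ν₁ + b * avgEnt P S s n ν₂ +
      (Real.negMulLog a + Real.negMulLog b) := by
  have key : ∀ t, labelEnt μ (itin S (ballLabel s t) n) ≤
      a * labelEnt ν₁ (itin S (ballLabel s t) n) + b * labelEnt ν₂ (itin S (ballLabel s t) n) +
        (Real.negMulLog a + Real.negMulLog b) := by
    intro t
    have hm := (measLabel_ballLabel s t).itin hS.measurable n
    set f := itin S (ballLabel s t) n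
    have h1 : ∀ u, Real.negMulLog (μ.real (f ⁻¹' {u})) ≤
        (ν₁.real (f ⁻¹' {u}) * Real.negMulLog a + a * Real.negMulLog (ν₁.real (f ⁻¹' {u}))) +
        (ν₂.real (f ⁻¹' {u}) * Real.negMulLog b + b * Real.negMulLog (ν₂.real (f ⁻¹' {u}))) := by
      intro u
      rw [h _ (hm u), ← Real.negMulLog_mul, ← Real.negMulLog_mul]
      have := negMulLog_sum_le Finset.univ
        ![a * ν₁.real (f ⁻¹' {u}), b * ν₂.real (f ⁻¹' {u})] (by
          intro j _
          fin_cases j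
          · exact mul_nonneg ha measureReal_nonneg
          · exact mul_nonneg hb measureReal_nonneg)
      simpa using this
    have h2 := Finset.sum_le_sum fun u (_ : u ∈ Finset.univ) => h1 u
    simp only [Finset.sum_add_distrib, ← Finset.sum_mul, ← Finset.mul_sum,
      hm.sum_measureReal] at h2
    simp only [labelEnt]
    linarith
  have i1 := (integrable_labelEnt_itin_ballLabel (P := P) (s := s) hS ν₁ n).const_mul a
  have i2 := (integrable_labelEnt_itin_ballLabel (P := P) (s := s) hS ν₂ n).const_mul b
  have i12 : Integrable (fun t => a * labelEnt ν₁ (itin S (ballLabel s t) n) +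
      b * labelEnt ν₂ (itin S (ballLabel s t) n)) P := i1.add i2
  have h3 := integral_mono (integrable_labelEnt_itin_ballLabel (P := P) (s := s) hS μ n)
    (i12.add (integrable_const (Real.negMulLog a + Real.negMulLog b))) key
  refine h3.trans_eq ?_
  simp only [Pi.add_apply, avgEnt]
  rw [integral_add i12 (integrable_const _), integral_add i1 i2, integral_const_mul,
    integral_const_mul]
  simp

lemma avgRate_le_add (hS : Continuous S) {μ ν₁ ν₂ : Measure Z} [IsProbabilityMeasure μ]
    [IsProbabilityMeasure ν₁] [IsProbabilityMeasure ν₂] (hμ : MeasurePreserving S μ μ)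
    (hν₁ : MeasurePreserving S ν₁ ν₁) (hν₂ : MeasurePreserving S ν₂ ν₂) {a b : ℝ} (ha : 0 ≤ a)
    (hb : 0 ≤ b) (h : ∀ A, MeasurableSet A → μ.real A = a * ν₁.real A + b * ν₂.real A) :
    avgRate P S s μ ≤ a * avgRate P S s ν₁ + b * avgRate P S s ν₂ := by
  have h1 := ((tendsto_avgRate (P := P) (s := s) hS hν₁).const_mul a).add
    ((tendsto_avgRate (P := P) (s := s) hS hν₂).const_mul b)
  have h2 := h1.add (tendsto_const_div_atTop_nhds_zero_nat (Real.negMulLog a + Real.negMulLog b))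
  rw [add_zero] at h2
  refine le_of_tendsto_of_tendsto' (tendsto_avgRate hS hμ) h2 fun n => ?_
  have := avgEnt_le_add (P := P) (s := s) hS ha hb h n
  calc _ ≤ _ := div_le_div_of_nonneg_right this n.cast_nonneg
    _ = _ := by ring

end BallLabels

section OrbitAverages

/-- The average of the images of `σ` under the first `n` iterates of `S`. -/
noncomputable def orbitAvg (S : X → X) (n : ℕ) (σ : Measure X) : Measure X :=
  (n : ENNReal)⁻¹ • ∑ i ∈ Finset.range n, σ.map S^[i]

variable {S : X → X} {n : ℕ} {σ : Measure X} [IsProbabilityMeasure σ]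

lemma orbitAvg_apply_real (hS : Measurable S) {A : Set X} (hA : MeasurableSet A) :
    (orbitAvg S n σ).real A = ∑ i ∈ Finset.range n, (n : ℝ)⁻¹ * σ.real (S^[i] ⁻¹' A) := by
  simp only [orbitAvg, Measure.real, Measure.smul_apply, Measure.finsetSum_apply, smul_eq_mul,
    ENNReal.toReal_mul, ENNReal.toReal_inv, ENNReal.toReal_natCast, ← Finset.mul_sum]
  rw [ENNReal.toReal_sum fun i _ => by
    rw [Measure.map_apply (hS.iterate i) hA]; exact measure_ne_top _ _]
  simp [Measure.map_apply (hS.iterate _) hA]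

lemma isProbabilityMeasure_orbitAvg (hS : Measurable S) (hn : n ≠ 0) :
    IsProbabilityMeasure (orbitAvg S n σ) := by
  constructor
  simp only [orbitAvg, Measure.smul_apply, Measure.finsetSum_apply, smul_eq_mul,
    Measure.map_apply (hS.iterate _) MeasurableSet.univ, Set.preimage_univ, measure_univ]
  simp [ENNReal.inv_mul_cancel (Nat.cast_ne_zero.2 hn) (ENNReal.natCast_ne_top n)]

lemma sum_labelEnt_comp_iterate_le {ι : Type*} [Fintype ι] (hS : Measurable S) (hn : n ≠ 0)
    {f : X → ι} (hf : MeasLabel f) :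
    ∑ i ∈ Finset.range n, labelEnt σ (fun x => f (S^[i] x)) ≤
      n * labelEnt (orbitAvg S n σ) f := by
  have hn' : (0 : ℝ) < n := by positivity
  simp only [labelEnt]
  rw [Finset.sum_comm, Finset.mul_sum]
  refine Finset.sum_le_sum fun u _ => ?_
  rw [orbitAvg_apply_real hS (hf u)]
  have := Real.concaveOn_negMulLog.le_map_sum (t := Finset.range n) (w := fun _ => (n : ℝ)⁻¹)
    (p := fun i => σ.real (S^[i] ⁻¹' (f ⁻¹' {u}))) (fun _ _ => by positivity)
    (by simp [hn'.ne']) fun _ _ => measureReal_nonneg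
  simp only [smul_eq_mul, ← Finset.mul_sum] at this
  rw [← Finset.mul_sum]
  rw [inv_mul_le_iff₀ hn'] at this
  exact this

lemma mul_labelEnt_itin_le_orbitAvg {ι : Type*} [Fintype ι] (hS : Measurable S) (hn : n ≠ 0)
    {f : X → ι} (hf : MeasLabel f) (q : ℕ) :
    q * labelEnt σ (itin S f n) ≤
      n * labelEnt (orbitAvg S n σ) (itin S f q) + q * (q * Real.log (Fintype.card ι)) :=
  (mul_labelEnt_itin_le hS hf q n).trans
    (add_le_add_left (sum_labelEnt_comp_iterate_le hS hn (hf.itin hS q)) _)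

lemma abs_integral_orbitAvg_comp_sub_le {Z : Type*} [TopologicalSpace Z] [MeasurableSpace Z]
    [OpensMeasurableSpace Z] {S : Z → Z} {σ : Measure Z} [IsProbabilityMeasure σ]
    (hS : Continuous S) (hS' : Measurable S) (n : ℕ) (φ : BoundedContinuousFunction Z ℝ) :
    |∫ x, φ (S x) ∂(orbitAvg S n σ) - ∫ x, φ x ∂(orbitAvg S n σ)| ≤ 2 * ‖φ‖ / n := by
  have key (ψ : BoundedContinuousFunction Z ℝ) : ∫ x, ψ x ∂(orbitAvg S n σ) =
      (n : ℝ)⁻¹ * ∑ i ∈ Finset.range n, ∫ x, ψ (S^[i] x) ∂σ := by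
    have (i : ℕ) : IsProbabilityMeasure (σ.map S^[i]) :=
      Measure.isProbabilityMeasure_map (hS'.iterate i).aemeasurable
    rw [orbitAvg, integral_smul_measure, integral_finsetSum_measure fun i _ => ψ.integrable _]
    simp only [ENNReal.toReal_inv, ENNReal.toReal_natCast, smul_eq_mul]
    congr 1
    refine Finset.sum_congr rfl fun i _ => ?_
    exact integral_map (hS'.iterate i).aemeasurable
      ψ.continuous.measurable.aestronglyMeasurable
  have hb (i : ℕ) : |∫ x, φ (S^[i] x) ∂σ| ≤ ‖φ‖ := by
    have := norm_integral_le_of_norm_le_const (μ := σ) (C := ‖φ‖)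
      (f := fun x => φ (S^[i] x)) (.of_forall fun x => φ.norm_coe_le_norm _)
    simpa using this
  have h1 := key (φ.compContinuous ⟨S, hS⟩)
  simp only [BoundedContinuousFunction.compContinuous_apply, ContinuousMap.coe_mk,
    ← Function.iterate_succ_apply' S] at h1
  rw [h1, key, ← mul_sub, ← Finset.sum_sub_distrib,
    Finset.sum_range_sub (fun i => ∫ x, φ (S^[i] x) ∂σ), abs_mul, abs_inv, Nat.abs_cast,
    div_eq_inv_mul]
  gcongr
  exact (abs_sub _ _).trans (by linarith [hb n, hb 0])

end OrbitAverages

section Separated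

variable {Z : Type*} [MetricSpace Z] [CompactSpace Z] [Nonempty Z] [MeasurableSpace Z]
  [BorelSpace Z]

lemma exists_log_covNfull_le_labelEnt {S : Z → Z} (hS : Continuous S) {U : Finset (Set Z)}
    (hUo : ∀ A ∈ U, IsOpen A) (hU : ⋃₀ (U : Set (Set Z)) = Set.univ) :
    ∃ (s : Finset Z) (r : ℝ), 0 < r ∧ ∀ n, ∃ σ : ProbabilityMeasure Z, ∀ t ∈ Set.Icc r (2 * r),
      Real.log (covNfull (joinN S U n)) ≤ labelEnt (σ : Measure Z) (itin S (ballLabel s t) n) := by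
  obtain ⟨δ, hδ, hleb⟩ := lebesgue_number_lemma_of_metric_sUnion (isCompact_univ (X := Z))
    (fun A hA => hUo A hA) hU.ge
  obtain ⟨C, -, hCfin, hC⟩ :=
    (isCompact_univ (X := Z)).finite_cover_balls (show (0 : ℝ) < δ / 4 by positivity)
  refine ⟨hCfin.toFinset, δ / 4, by positivity, fun n => ?_⟩
  set s : Finset Z := hCfin.toFinset
  have hs {t : ℝ} (ht : δ / 4 ≤ t) (x : Z) : ∃ c ∈ s, dist x c < t := by
    obtain ⟨c, hc, hx⟩ := Set.mem_iUnion₂.1 (hC (Set.mem_univ x))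
    exact ⟨c, hCfin.mem_toFinset.2 hc, (Metric.mem_ball.1 hx).trans_le ht⟩
  let sep (E : Finset Z) : Prop := ∀ x ∈ E, ∀ y ∈ E, x ≠ y → ∃ i < n, δ ≤ dist (S^[i] x) (S^[i] y)
  have hinj {E : Finset Z} (hE : sep E) {t : ℝ} (ht : t ∈ Set.Icc (δ / 4) (2 * (δ / 4))) :
      Set.InjOn (itin S (ballLabel s t) n) E := by
    intro x hx y hy hxy
    by_contra hne
    obtain ⟨i, hi, hd⟩ := hE x hx y hy hne
    have := dist_lt_of_ballLabel_eq (hs ht.1) (congrFun hxy ⟨i, hi⟩)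
    linarith [ht.2]
  obtain ⟨N, ⟨E, hE, rfl⟩, hmax⟩ := BddAbove.exists_isGreatest_of_nonempty
    (S := {k | ∃ E : Finset Z, sep E ∧ E.card = k}) ⟨Fintype.card (Fin n → s → Bool), by
      rintro _ ⟨E, hE, rfl⟩
      exact Finset.card_le_card_of_injOn _ (fun _ _ => Finset.mem_univ _)
        (hinj hE (t := δ / 4) ⟨le_rfl, by linarith⟩)⟩ ⟨0, ∅, by simp [sep], rfl⟩
  have hnear (x : Z) : ∃ e ∈ E, ∀ i < n, dist (S^[i] x) (S^[i] e) < δ := by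
    by_contra! h
    have hxE : x ∉ E := fun hx => by
      obtain ⟨i, -, hi⟩ := h x hx
      rw [dist_self] at hi
      linarith
    have := hmax ⟨insert x E, ?_, rfl⟩
    · rw [Finset.card_insert_of_notMem hxE] at this
      omega
    · intro y hy z hz hyz
      rcases Finset.mem_insert.1 hy with rfl | hy' <;>
        rcases Finset.mem_insert.1 hz with rfl | hz'
      · exact absurd rfl hyz
      · exact h z hz'
      · obtain ⟨i, hi, hd⟩ := h y hy'
        exact ⟨i, hi, dist_comm (S^[i] y) _ ▸ hd⟩
      · exact hE y hy' z hz' hyz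
  have hEpos : 0 < E.card := by
    obtain ⟨e, he, -⟩ := hnear (Classical.arbitrary Z)
    exact Finset.card_pos.2 ⟨e, he⟩
  have hcov : covNfull (joinN S U n) ≤ E.card := by
    have hball (y : Z) : ∃ A ∈ U, Metric.ball y δ ⊆ A := hleb y trivial
    choose c hc hsub using hball
    refine covNfull_le_card E (fun e => {x | ∀ i < n, S^[i] x ∈ c (S^[i] e)})
      (fun e _ => mem_joinN.2 ⟨fun i => c (S^[i] e), fun i _ => hc _, rfl⟩) fun x => ?_
    obtain ⟨e, he, hd⟩ := hnear x
    exact ⟨e, he, fun i hi => hsub _ (Metric.mem_ball.2 (hd i hi))⟩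
  set σ : Measure Z := ∑ e ∈ E, (E.card : ENNReal)⁻¹ • Measure.dirac e with hσ
  have hreal {A : Set Z} (hA : MeasurableSet A) :
      σ A = (E.card : ENNReal)⁻¹ * (E.filter (· ∈ A)).card := by
    simp only [hσ, Measure.finsetSum_apply, Measure.smul_apply, Measure.dirac_apply' _ hA,
      Set.indicator_apply, Pi.one_apply, smul_eq_mul, ← Finset.mul_sum, Finset.sum_boole]
  have hprob : IsProbabilityMeasure σ := by
    refine ⟨?_⟩
    rw [hreal .univ]
    simpa using ENNReal.inv_mul_cancel (by exact_mod_cast hEpos.ne') (ENNReal.natCast_ne_top _)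
  refine ⟨⟨σ, hprob⟩, fun t ht => ?_⟩
  change _ ≤ labelEnt σ _
  refine (Real.log_le_log (by exact_mod_cast covNfull_pos (exists_mem_joinN hU n))
    (Nat.cast_le.2 hcov)).trans ?_
  have hm := (measLabel_ballLabel s t).itin hS.measurable n
  refine log_le_labelEnt hm fun u => ?_
  have hcard : (E.filter (· ∈ itin S (ballLabel s t) n ⁻¹' {u})).card ≤ 1 := by
    refine Finset.card_le_one.2 fun x hx y hy => ?_
    simp only [Finset.mem_filter, Set.mem_preimage, Set.mem_singleton_iff] at hx hy
    exact hinj hE ht hx.1 hy.1 (hx.2.trans hy.2.symm)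
  simp only [Measure.real]
  rw [hreal (hm u), ENNReal.toReal_mul, ENNReal.toReal_inv, ENNReal.toReal_natCast,
    ENNReal.toReal_natCast]
  exact mul_le_of_le_one_right (by positivity) (by exact_mod_cast hcard)

end Separated

section InvariantMeasures

variable {Z : Type*} [MetricSpace Z] [CompactSpace Z] [MeasurableSpace Z] [BorelSpace Z]
  {P : Measure ℝ} [IsProbabilityMeasure P] {S : Z → Z} {s : Finset Z}

omit [CompactSpace Z] in
lemma mul_le_avgEnt_orbitAvg (hS : Continuous S) {n : ℕ} (hn : n ≠ 0) {σ : Measure Z}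
    [IsProbabilityMeasure σ] {L : ℝ} (hL : ∀ᵐ t ∂P, L ≤ labelEnt σ (itin S (ballLabel s t) n))
    (q : ℕ) : q * L ≤ n * avgEnt P S s q (orbitAvg S n σ) +
      q * (q * Real.log (Fintype.card (s → Bool))) := by
  have := isProbabilityMeasure_orbitAvg (σ := σ) hS.measurable hn
  have hi := (integrable_labelEnt_itin_ballLabel (P := P) (s := s) hS (orbitAvg S n σ) q).const_mul
    (n : ℝ)
  have h1 : ∫ _, q * L ∂P ≤ ∫ t, (n * labelEnt (orbitAvg S n σ) (itin S (ballLabel s t) q) +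
      q * (q * Real.log (Fintype.card (s → Bool)))) ∂P := by
    refine integral_mono_ae (integrable_const _) (hi.add (integrable_const _)) ?_
    filter_upwards [hL] with t ht
    exact (mul_le_mul_of_nonneg_left ht q.cast_nonneg).trans
      (mul_labelEnt_itin_le_orbitAvg hS.measurable hn (measLabel_ballLabel s t) q)
  rw [integral_add hi (integrable_const _), integral_const_mul (n : ℝ)] at h1
  simpa only [integral_const, probReal_univ, one_smul, avgEnt] using h1

lemma exists_measurePreserving_le_avgRate (hP : P ≪ volume) (hS : Continuous S) {L : ℕ → ℝ}
    {h : ℝ} (hL : Tendsto (fun n : ℕ => L n / n) atTop (𝓝 h))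
    (hσ : ∀ n, ∃ σ : ProbabilityMeasure Z,
      ∀ᵐ t ∂P, L n ≤ labelEnt (σ : Measure Z) (itin S (ballLabel s t) n)) :
    ∃ μ : ProbabilityMeasure Z, MeasurePreserving S (μ : Measure Z) μ ∧
      h ≤ avgRate P S s (μ : Measure Z) := by
  choose σ hσ using hσ
  let m (k : ℕ) : ProbabilityMeasure Z :=
    ⟨orbitAvg S (k + 1) (σ (k + 1) : Measure Z),
      isProbabilityMeasure_orbitAvg hS.measurable k.succ_ne_zero⟩
  obtain ⟨μ, -, hμ⟩ := isCompact_univ.ultrafilter_le_nhds ((hyperfilter ℕ).map m) (by simp)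
  have hm : Tendsto m (hyperfilter ℕ) (𝓝 μ) := hμ
  have hle : (hyperfilter ℕ : Filter ℕ) ≤ atTop := Nat.hyperfilter_le_atTop
  have hinv : MeasurePreserving S (μ : Measure Z) μ := by
    refine ⟨hS.measurable, ?_⟩
    have := Measure.isProbabilityMeasure_map (μ := (μ : Measure Z)) hS.measurable.aemeasurable
    refine ext_of_forall_integral_eq_of_IsFiniteMeasure fun φ => ?_
    rw [integral_map hS.measurable.aemeasurable φ.continuous.measurable.aestronglyMeasurable]
    have h1 := ((ProbabilityMeasure.continuous_integral_boundedContinuousFunction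
      (φ.compContinuous ⟨S, hS⟩)).tendsto μ).comp hm
    have h2 := ((ProbabilityMeasure.continuous_integral_boundedContinuousFunction
      φ).tendsto μ).comp hm
    refine sub_eq_zero.1 (tendsto_nhds_unique (h1.sub h2) ?_)
    refine squeeze_zero_norm (fun k => abs_integral_orbitAvg_comp_sub_le hS hS.measurable (k + 1) φ)
      (Tendsto.mono_left ?_ hle)
    exact (tendsto_const_div_atTop_nhds_zero_nat (2 * ‖φ‖)).comp (tendsto_add_atTop_nat 1)
  have hent (q : ℕ) : q * h ≤ avgEnt P S s q (μ : Measure Z) := by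
    have h1 := ((continuous_avgEnt (s := s) hP hS q).tendsto μ).comp hm
    have h2 := (((hL.comp (tendsto_add_atTop_nat 1)).mono_left hle).const_mul (q : ℝ))
    have h3 := (((tendsto_const_div_atTop_nhds_zero_nat
      (q * (q * Real.log (Fintype.card (s → Bool))))).comp (tendsto_add_atTop_nat 1)).mono_left hle)
    have h4 := h1.add h3
    rw [add_zero] at h4
    refine le_of_tendsto_of_tendsto' h2 h4 fun k => ?_
    have h5 := mul_le_avgEnt_orbitAvg hS k.succ_ne_zero (hσ (k + 1)) q
    have hk : (0 : ℝ) < (k + 1 : ℕ) := by positivity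
    simp only [Function.comp_apply]
    rw [← mul_div_assoc, div_le_iff₀ hk, add_mul, div_mul_cancel₀ _ hk.ne',
      mul_comm (avgEnt _ _ _ _ _)]
    exact h5
  refine ⟨μ, hinv, ge_of_tendsto (tendsto_avgRate hS hinv) ?_⟩
  filter_upwards [eventually_ne_atTop 0] with n hn
  rw [le_div_iff₀ (by positivity), mul_comm]
  exact hent n

omit [CompactSpace Z] in
lemma isClosed_setOf_measurePreserving (hS : Continuous S) :
    IsClosed {μ : ProbabilityMeasure Z | MeasurePreserving S (μ : Measure Z) μ} := by
  have : {μ : ProbabilityMeasure Z | MeasurePreserving S (μ : Measure Z) μ} =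
      {μ | μ.map hS.measurable.aemeasurable = μ} := by
    ext μ
    exact ⟨fun h => Subtype.ext h.map_eq, fun h => ⟨hS.measurable, congrArg Subtype.val h⟩⟩
  rw [this]
  exact isClosed_eq (ProbabilityMeasure.continuous_map hS) continuous_id

lemma upperSemicontinuousOn_avgRate (hP : P ≪ volume) (hS : Continuous S) :
    UpperSemicontinuousOn (fun μ : ProbabilityMeasure Z => avgRate P S s (μ : Measure Z))
      {μ | MeasurePreserving S (μ : Measure Z) μ} := by
  intro μ hμ y hy
  obtain ⟨n, hn, hlt⟩ := ((eventually_ne_atTop 0).and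
    ((tendsto_avgRate (P := P) (s := s) hS hμ).eventually_lt_const hy)).exists
  have hc : Continuous fun ν : ProbabilityMeasure Z => avgEnt P S s n (ν : Measure Z) / n :=
    (continuous_avgEnt hP hS n).div_const _
  filter_upwards [nhdsWithin_le_nhds (hc.continuousAt.eventually_lt_const hlt),
    self_mem_nhdsWithin] with ν hν hI
  exact (avgRate_le_div hS hI hn).trans_lt hν

lemma isClosed_setOf_le_avgRate (hP : P ≪ volume) (hS : Continuous S) (M : ℝ) :
    IsClosed {μ : ProbabilityMeasure Z | MeasurePreserving S (μ : Measure Z) μ ∧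
      M ≤ avgRate P S s (μ : Measure Z)} := by
  have : {μ : ProbabilityMeasure Z | MeasurePreserving S (μ : Measure Z) μ ∧
      M ≤ avgRate P S s (μ : Measure Z)} =
      {μ : ProbabilityMeasure Z | MeasurePreserving S (μ : Measure Z) μ} ∩
        ⋂ n : ℕ, ⋂ _ : n ≠ 0, {μ : ProbabilityMeasure Z |
          M ≤ avgEnt P S s n (μ : Measure Z) / n} := by
    ext μ
    simp only [Set.mem_ofPred_eq, Set.mem_inter_iff, Set.mem_iInter]
    refine and_congr_right fun hμ => ⟨fun h n hn => h.trans (avgRate_le_div hS hμ hn), fun h => ?_⟩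
    refine ge_of_tendsto (tendsto_avgRate hS hμ) ?_
    filter_upwards [eventually_ne_atTop 0] with n hn using h n hn
  rw [this]
  exact (isClosed_setOf_measurePreserving hS).inter <| isClosed_iInter fun n =>
    isClosed_iInter fun _ => isClosed_le continuous_const ((continuous_avgEnt hP hS n).div_const _)

lemma measurePreserving_cond {S : X → X} {μ : Measure X} (hμ : MeasurePreserving S μ μ)
    {A : Set X} (hA : MeasurableSet A) (h : S ⁻¹' A = A) :
    MeasurePreserving S (ProbabilityTheory.cond μ A) (ProbabilityTheory.cond μ A) := by
  have := (hμ.restrict_preimage hA).smul_measure (μ A)⁻¹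
  rwa [h] at this

lemma measureReal_eq_add_cond (μ : Measure X) [IsFiniteMeasure μ] {A : Set X}
    (hA : MeasurableSet A) (B : Set X) :
    μ.real B = μ.real A * (ProbabilityTheory.cond μ A).real B +
      μ.real Aᶜ * (ProbabilityTheory.cond μ Aᶜ).real B := by
  have c1 := congrArg ENNReal.toReal (ProbabilityTheory.cond_mul_eq_inter hA B μ)
  have c2 := congrArg ENNReal.toReal (ProbabilityTheory.cond_mul_eq_inter hA.compl B μ)
  rw [ENNReal.toReal_mul] at c1 c2
  have c3 := measureReal_inter_add_sdiff (μ := μ) (s := B) hA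
  rw [Set.sdiff_eq, Set.inter_comm, Set.inter_comm B] at c3
  rw [← c3]
  simp only [Measure.real]
  rw [← c1, ← c2]
  ring

lemma integral_eq_add_cond {μ : Measure X} [IsFiniteMeasure μ] {A : Set X} (hA : MeasurableSet A)
    (h0 : μ A ≠ 0) (h1 : μ Aᶜ ≠ 0) {g : X → ℝ} (hg : Integrable g μ) :
    ∫ x, g x ∂μ = μ.real A * ∫ x, g x ∂(ProbabilityTheory.cond μ A) +
      μ.real Aᶜ * ∫ x, g x ∂(ProbabilityTheory.cond μ Aᶜ) := by
  have ha : (μ A).toReal ≠ 0 := (ENNReal.toReal_pos h0 (measure_ne_top _ _)).ne'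
  have hb : (μ Aᶜ).toReal ≠ 0 := (ENNReal.toReal_pos h1 (measure_ne_top _ _)).ne'
  rw [← integral_add_compl hA hg]
  simp only [ProbabilityTheory.cond, integral_smul_measure, ENNReal.toReal_inv, smul_eq_mul,
    Measure.real]
  rw [mul_inv_cancel_left₀ ha, mul_inv_cancel_left₀ hb]

omit [CompactSpace Z] in
/-- A compact nonempty set of probability measures contains one which is not a proper convex
combination of two different members. -/
lemma exists_forall_convexComb_eq {K : Set (ProbabilityMeasure Z)} (hK : IsCompact K)
    (hne : K.Nonempty) :
    ∃ μ ∈ K, ∀ ν₁ ∈ K, ∀ ν₂ ∈ K, ∀ a b : ℝ, 0 < a → 0 < b → a + b = 1 →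
      (∀ φ : BoundedContinuousFunction Z ℝ, ∫ x, φ x ∂(μ : Measure Z) =
        a * ∫ x, φ x ∂(ν₁ : Measure Z) + b * ∫ x, φ x ∂(ν₂ : Measure Z)) → ν₁ = ν₂ := by
  let e (μ : ProbabilityMeasure Z) (φ : BoundedContinuousFunction Z ℝ) : ℝ :=
    ∫ x, φ x ∂(μ : Measure Z)
  have he : Continuous e :=
    continuous_pi fun φ => ProbabilityMeasure.continuous_integral_boundedContinuousFunction φ
  obtain ⟨_, hx⟩ := (hK.image he).extremePoints_nonempty (hne.image e)
  obtain ⟨⟨μ, hμ, rfl⟩, hext⟩ := mem_extremePoints.1 hx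
  refine ⟨μ, hμ, fun ν₁ h₁ ν₂ h₂ a b ha hb hab h => ?_⟩
  obtain ⟨e1, e2⟩ := hext _ (Set.mem_image_of_mem e h₁) _ (Set.mem_image_of_mem e h₂)
    ⟨a, b, ha, hb, hab, funext fun φ => (h φ).symm⟩
  have h12 : (ν₁ : Measure Z) = ν₂ := ext_of_forall_integral_eq_of_IsFiniteMeasure fun φ =>
    congrFun (e1.trans e2.symm) φ
  exact Subtype.ext h12

lemma exists_ergodic_le_avgRate (hP : P ≪ volume) (hS : Continuous S) {μ₀ : ProbabilityMeasure Z}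
    (hμ₀ : MeasurePreserving S (μ₀ : Measure Z) μ₀) :
    ∃ μ : ProbabilityMeasure Z, Ergodic S (μ : Measure Z) ∧
      avgRate P S s (μ₀ : Measure Z) ≤ avgRate P S s (μ : Measure Z) := by
  obtain ⟨μ₁, hμ₁, hmax⟩ := UpperSemicontinuousOn.exists_isMaxOn ⟨μ₀, hμ₀⟩
    (isClosed_setOf_measurePreserving hS).isCompact (upperSemicontinuousOn_avgRate (s := s) hP hS)
  obtain ⟨μ, ⟨hμ, hM⟩, hext⟩ := exists_forall_convexComb_eq
    (isClosed_setOf_le_avgRate (s := s) hP hS (avgRate P S s (μ₁ : Measure Z))).isCompact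
    ⟨μ₁, hμ₁, le_rfl⟩
  refine ⟨μ, ⟨hμ, ⟨fun A hA hSA => ?_⟩⟩, (hmax hμ₀).trans hM⟩
  by_contra hconst
  rw [eventuallyConst_set', not_or, ae_eq_empty, ae_eq_univ] at hconst
  obtain ⟨h0, h1⟩ := hconst
  have p1 := ProbabilityTheory.cond_isProbabilityMeasure h0
  have p2 := ProbabilityTheory.cond_isProbabilityMeasure h1
  have m1 := measurePreserving_cond hμ hA hSA
  have m2 := measurePreserving_cond hμ hA.compl (by rw [Set.preimage_compl, hSA])
  have hreal := fun B (_ : MeasurableSet B) => measureReal_eq_add_cond (μ : Measure Z) hA B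
  have hintegral := fun φ : BoundedContinuousFunction Z ℝ =>
    integral_eq_add_cond hA h0 h1 (φ.integrable (μ : Measure Z))
  have e1 : ProbabilityTheory.cond (μ : Measure Z) A A = 1 :=
    ProbabilityTheory.cond_apply_self h0 (measure_ne_top _ _)
  have e2 : ProbabilityTheory.cond (μ : Measure Z) Aᶜ A = 0 := by
    rw [ProbabilityTheory.cond_apply hA.compl, Set.compl_inter_self, measure_empty, mul_zero]
  have ha : 0 < (μ : Measure Z).real A := ENNReal.toReal_pos h0 (measure_ne_top _ _)
  have hb : 0 < (μ : Measure Z).real Aᶜ := ENNReal.toReal_pos h1 (measure_ne_top _ _)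
  have hab := probReal_add_probReal_compl (μ := (μ : Measure Z)) hA
  generalize (μ : Measure Z).real A = a at *
  generalize (μ : Measure Z).real Aᶜ = b at *
  generalize ProbabilityTheory.cond (μ : Measure Z) A = ν₁ at *
  generalize ProbabilityTheory.cond (μ : Measure Z) Aᶜ = ν₂ at *
  have hle := avgRate_le_add (P := P) (s := s) hS hμ m1 m2 ha.le hb.le hreal
  have l1 : avgRate P S s ν₁ ≤ avgRate P S s (μ₁ : Measure Z) :=
    isMaxOn_iff.1 hmax ⟨ν₁, p1⟩ m1
  have l2 : avgRate P S s ν₂ ≤ avgRate P S s (μ₁ : Measure Z) :=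
    isMaxOn_iff.1 hmax ⟨ν₂, p2⟩ m2
  have hsplit : avgRate P S s (μ₁ : Measure Z) =
      a * avgRate P S s (μ₁ : Measure Z) + b * avgRate P S s (μ₁ : Measure Z) := by
    rw [← add_mul, hab, one_mul]
  have g1 : avgRate P S s (μ₁ : Measure Z) ≤ avgRate P S s ν₁ := by
    by_contra! hlt
    linarith [mul_lt_mul_of_pos_left hlt ha, mul_le_mul_of_nonneg_left l2 hb.le]
  have g2 : avgRate P S s (μ₁ : Measure Z) ≤ avgRate P S s ν₂ := by
    by_contra! hlt
    linarith [mul_lt_mul_of_pos_left hlt hb, mul_le_mul_of_nonneg_left l1 ha.le]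
  have heq : ν₁ A = ν₂ A := congrArg (fun ν : ProbabilityMeasure Z => (ν : Measure Z) A)
    (hext ⟨ν₁, p1⟩ ⟨m1, g1⟩ ⟨ν₂, p2⟩ ⟨m2, g2⟩ a b ha hb hab hintegral)
  rw [e1, e2] at heq
  exact one_ne_zero heq

lemma exists_ergodic_coverRate_le_hKS [Nonempty Z] (hS : Continuous S) {U : Finset (Set Z)}
    (hUo : ∀ A ∈ U, IsOpen A) (hU : ⋃₀ (U : Set (Set Z)) = Set.univ) :
    ∃ μ : ProbabilityMeasure Z, Ergodic S (μ : Measure Z) ∧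
      ENNReal.ofReal (coverRate S U) ≤ hKS (μ : Measure Z) S := by
  obtain ⟨s, r, hr, hσ⟩ := exists_log_covNfull_le_labelEnt hS hUo hU
  let P : Measure ℝ := ProbabilityTheory.cond volume (Set.Icc r (2 * r))
  have hP : P ≪ volume := ProbabilityTheory.cond_absolutelyContinuous
  have hvol : volume (Set.Icc r (2 * r)) ≠ 0 := by
    rw [Real.volume_Icc]
    simp only [ne_eq, ENNReal.ofReal_eq_zero, not_le]
    linarith
  have : IsProbabilityMeasure P :=
    ProbabilityTheory.cond_isProbabilityMeasure_of_finite hvol (by simp)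
  obtain ⟨μ₀, hμ₀, h₀⟩ := exists_measurePreserving_le_avgRate (s := s) hP hS (tendsto_coverRate hU)
    fun n => (hσ n).imp fun σ h => (ProbabilityTheory.ae_cond_mem measurableSet_Icc).mono h
  obtain ⟨μ, hμ, hle⟩ := exists_ergodic_le_avgRate (s := s) hP hS hμ₀
  refine ⟨μ, hμ, ?_⟩
  by_cases htop : hKS (μ : Measure Z) S = ⊤
  · simp [htop]
  refine ENNReal.ofReal_le_of_le_toReal ((h₀.trans hle).trans ?_)
  refine avgRate_le_of_forall_labelRate_le hS hμ.toMeasurePreserving fun t => ?_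
  exact (ENNReal.ofReal_le_iff_le_toReal htop).1 (ofReal_labelRate_le_hKS (measLabel_ballLabel s t))

end InvariantMeasures

/-- **Variational Principle.** For a topological dynamical system
`(X, T)`: (a) `h_μ(T) ≤ h_top(T)` for every `T`-invariant Borel probability
measure `μ`; (b) `sup {h_μ(T) : μ ergodic invariant} = h_top(T)`. -/
theorem variational_principle {X : Type*} [MetricSpace X] [CompactSpace X] [Nonempty X]
    [MeasurableSpace X] [BorelSpace X] (T : X ≃ₜ X) :
    (∀ μ : Measure X, IsProbabilityMeasure μ → MeasurePreserving ⇑T μ μ →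
      hKS μ ⇑T ≤ hTop ⇑T) ∧
    (⨆ μ : {μ : Measure X // IsProbabilityMeasure μ ∧ Ergodic ⇑T μ}, hKS (↑μ) ⇑T)
      = hTop ⇑T := by
  refine ⟨fun μ _ hμ => hKS_le_hTop hμ, le_antisymm ?_ ?_⟩
  · exact iSup_le fun ⟨μ, hp, hμ⟩ => hKS_le_hTop hμ.toMeasurePreserving
  · refine iSup_le fun ⟨U, hUo, hU⟩ => ?_
    obtain ⟨μ, hμ, hle⟩ := exists_ergodic_coverRate_le_hKS T.continuous hUo hU
    exact le_iSup_of_le ⟨(μ : Measure X), inferInstance, hμ⟩ hle
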